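/- Let μ be a modulus of continuity with ∫₀¹ 1/μ(s) ds < +∞. Then there exists a function l ∈ C^μ(ℝ) with 1/2 ≤ l(t) ≤ 3/2 for all t ∈ ℝ, and there exist functions u, b₁, b₂, c ∈ C^∞_b(ℝ_t × ℝ²_x) with supp u = {(t,x₁,x₂) : t ≥ 0}, such that ∂_t u + ∂²_{x₁} u + l(t) ∂²_{x₂} u + b₁ ∂_{x₁} u + b₂ ∂_{x₂} u + c u = 0 on all of ℝ × ℝ². In particular, u is a nonzero solution of a uniformly parabolic backward equation with coefficients of modulus of continuity μ that vanishes identically for t ≤ 0. -/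

import Mathlib

/-- A function on `ℝ_t × ℝ²_x` is in `C^∞_b` if it is smooth and bounded together
with all its derivatives. -/
def CinftyB (f : ℝ × ℝ × ℝ → ℝ) : Prop :=
  ContDiff ℝ (⊤ : ℕ∞) f ∧ ∀ k : ℕ, ∃ M, ∀ p, ‖iteratedFDeriv ℝ k f p‖ ≤ M

/-! ### Families with moderate / negligible derivative bounds -/

namespace Plis

open Real Set Filter Topology

/-- Moderate sequences (polynomially bounded in `1/τ`). -/
def IsMod (τ v : ℕ → ℝ) : Prop := ∃ C : ℝ, ∃ N : ℕ, ∀ k, |v k| ≤ C * ((τ k)⁻¹) ^ N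

/-- Negligible sequences (smaller than every power of `τ`). -/
def IsNeg (τ v : ℕ → ℝ) : Prop := ∀ N : ℕ, ∃ C : ℝ, ∀ k, |v k| ≤ C * (τ k) ^ N

/-- `U` is a module over the moderate sequences. -/
structure Cls (τ : ℕ → ℝ) (U : (ℕ → ℝ) → Prop) : Prop where
  add : ∀ {v w}, U v → U w → U (fun k => v k + w k)
  mul : ∀ {v w}, IsMod τ v → U w → U (fun k => v k * w k)
  zero : U (fun _ => 0)

/-- Derivative bounds of order up to `n` in the class `U`. -/
def Cl {E : Type*} [NormedAddCommGroup E] [NormedSpace ℝ E] (U : (ℕ → ℝ) → Prop) (n : ℕ)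
    (F : ℕ → E → ℝ) : Prop :=
  (∀ k, ContDiff ℝ (⊤ : ℕ∞) (F k)) ∧
    ∀ j ≤ n, ∃ v, U v ∧ ∀ k x, ‖iteratedFDeriv ℝ j (F k) x‖ ≤ v k

section
variable {τ : ℕ → ℝ}

theorem IsMod.const (c : ℝ) : IsMod τ (fun _ => c) := ⟨|c|, 0, by simp⟩

theorem isMod_inv (hpos : ∀ k, 0 < τ k) (N : ℕ) : IsMod τ (fun k => (τ k)⁻¹ ^ N) :=
  ⟨1, N, fun k => by rw [abs_of_nonneg (by have := hpos k; positivity)]; simp⟩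

theorem IsMod.mono {v w : ℕ → ℝ} (h : IsMod τ w) (hv : ∀ k, |v k| ≤ |w k|) : IsMod τ v := by
  obtain ⟨C, N, h⟩ := h
  exact ⟨C, N, fun k => (hv k).trans (h k)⟩

theorem IsNeg.mono {v w : ℕ → ℝ} (h : IsNeg τ w) (hv : ∀ k, |v k| ≤ |w k|) : IsNeg τ v := by
  intro N
  obtain ⟨C, h⟩ := h N
  exact ⟨C, fun k => (hv k).trans (h k)⟩

theorem nonneg_of_bound (hpos : ∀ k, 0 < τ k) {v : ℕ → ℝ} {C : ℝ} {N : ℕ} (h : ∀ k, |v k| ≤ C * ((τ k)⁻¹) ^ N) :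
    0 ≤ C := by
  have h0 := (abs_nonneg _).trans (h 0)
  have : 0 < ((τ 0)⁻¹) ^ N := by have := hpos 0; positivity
  exact nonneg_of_mul_nonneg_left h0 this

theorem nonneg_of_bound' (hpos : ∀ k, 0 < τ k) {v : ℕ → ℝ} {C : ℝ} {N : ℕ} (h : ∀ k, |v k| ≤ C * ((τ k)) ^ N) :
    0 ≤ C := by
  have h0 := (abs_nonneg _).trans (h 0)
  have : 0 < ((τ 0)) ^ N := by have := hpos 0; positivity
  exact nonneg_of_mul_nonneg_left h0 this

theorem cls_mod (hpos : ∀ k, 0 < τ k) (hle : ∀ k, τ k ≤ 1) : Cls τ (IsMod τ) where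
  add := by
    rintro v w ⟨C, N, h⟩ ⟨C', N', h'⟩
    have hC := nonneg_of_bound hpos h
    have hC' := nonneg_of_bound hpos h'
    refine ⟨C + C', N + N', fun k => ?_⟩
    have h1 : 1 ≤ (τ k)⁻¹ := (one_le_inv₀ (hpos k)).2 (hle k)
    calc |v k + w k| ≤ |v k| + |w k| := abs_add_le _ _
      _ ≤ C * ((τ k)⁻¹) ^ N + C' * ((τ k)⁻¹) ^ N' := add_le_add (h k) (h' k)
      _ ≤ C * ((τ k)⁻¹) ^ (N + N') + C' * ((τ k)⁻¹) ^ (N + N') := by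
          gcongr <;> first | exact h1 | omega
      _ = _ := by ring
  mul := by
    rintro v w ⟨C, N, h⟩ ⟨C', N', h'⟩
    have hC := nonneg_of_bound hpos h
    refine ⟨C * C', N + N', fun k => ?_⟩
    have := hpos k
    calc |v k * w k| = |v k| * |w k| := abs_mul _ _
      _ ≤ (C * ((τ k)⁻¹) ^ N) * (C' * ((τ k)⁻¹) ^ N') := by
          gcongr
          · exact h k
          · exact h' k
      _ = _ := by ring
  zero := ⟨0, 0, by simp⟩

theorem cls_neg (hpos : ∀ k, 0 < τ k) : Cls τ (IsNeg τ) where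
  add := by
    intro v w h h' N
    obtain ⟨C, h⟩ := h N
    obtain ⟨C', h'⟩ := h' N
    refine ⟨C + C', fun k => ?_⟩
    calc |v k + w k| ≤ |v k| + |w k| := abs_add_le _ _
      _ ≤ _ := add_le_add (h k) (h' k)
      _ = _ := by ring
  mul := by
    intro v w h h' N
    obtain ⟨C, M, h⟩ := h
    obtain ⟨C', h'⟩ := h' (M + N)
    have hC := nonneg_of_bound hpos h
    refine ⟨C * C', fun k => ?_⟩
    have := hpos k
    calc |v k * w k| = |v k| * |w k| := abs_mul _ _
      _ ≤ (C * ((τ k)⁻¹) ^ M) * (C' * (τ k) ^ (M + N)) := by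
          gcongr
          · exact h k
          · exact h' k
      _ = C * C' * τ k ^ N * ((τ k)⁻¹ * τ k) ^ M := by ring
      _ = _ := by rw [inv_mul_cancel₀ this.ne']; ring
  zero := fun N => ⟨0, by simp⟩

theorem Cls.sum {U : (ℕ → ℝ) → Prop} (hU : Cls τ U) {ι : Type*} (s : Finset ι)
    (v : ι → ℕ → ℝ) (h : ∀ i ∈ s, U (v i)) : U (fun k => ∑ i ∈ s, v i k) := by
  classical
  induction s using Finset.induction_on with
  | empty => simpa using hU.zero
  | insert a s ha ih =>
    have h1 := ih (fun i hi => h i (Finset.mem_insert_of_mem hi))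
    have h2 := hU.add (h a (Finset.mem_insert_self _ _)) h1
    simpa [Finset.sum_insert ha] using h2

variable {E : Type*} [NormedAddCommGroup E] [NormedSpace ℝ E]
variable {U : (ℕ → ℝ) → Prop} {F G : ℕ → E → ℝ} {n : ℕ}

theorem Cl.mono {m : ℕ} (h : Cl U n F) (hm : m ≤ n) : Cl U m F :=
  ⟨h.1, fun j hj => h.2 j (hj.trans hm)⟩

theorem Cl.add (hU : Cls τ U) (hF : Cl U n F) (hG : Cl U n G) :
    Cl U n (fun k x => F k x + G k x) := by
  refine ⟨fun k => (hF.1 k).add (hG.1 k), fun j hj => ?_⟩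
  obtain ⟨v, hv, hv'⟩ := hF.2 j hj
  obtain ⟨w, hw, hw'⟩ := hG.2 j hj
  refine ⟨_, hU.add hv hw, fun k x => ?_⟩
  have e : iteratedFDeriv ℝ j (fun x => F k x + G k x) x
      = iteratedFDeriv ℝ j (F k) x + iteratedFDeriv ℝ j (G k) x :=
    iteratedFDeriv_add_apply (((hF.1 k).of_le (by exact_mod_cast le_top)).contDiffAt)
      (((hG.1 k).of_le (by exact_mod_cast le_top)).contDiffAt)
  rw [e]
  exact (norm_add_le _ _).trans (add_le_add (hv' k x) (hw' k x))

theorem Cl.mul (hU : Cls τ U) (hF : Cl (IsMod τ) n F) (hG : Cl U n G) :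
    Cl U n (fun k x => F k x * G k x) := by
  refine ⟨fun k => (hF.1 k).mul (hG.1 k), fun j hj => ?_⟩
  have hv : ∀ i, ∃ v : ℕ → ℝ, i ≤ j → (IsMod τ v ∧ ∀ k x, ‖iteratedFDeriv ℝ i (F k) x‖ ≤ v k) := by
    intro i
    by_cases hi : i ≤ j
    · obtain ⟨v, h⟩ := hF.2 i (hi.trans hj)
      exact ⟨v, fun _ => h⟩
    · exact ⟨0, fun h => absurd h hi⟩
  have hw : ∀ i, ∃ v : ℕ → ℝ, i ≤ j → (U v ∧ ∀ k x, ‖iteratedFDeriv ℝ i (G k) x‖ ≤ v k) := by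
    intro i
    by_cases hi : i ≤ j
    · obtain ⟨v, h⟩ := hG.2 i (hi.trans hj)
      exact ⟨v, fun _ => h⟩
    · exact ⟨0, fun h => absurd h hi⟩
  choose v hv using hv
  choose w hw using hw
  refine ⟨fun k => ∑ i ∈ Finset.range (j + 1), (j.choose i : ℝ) * (v i k * w (j - i) k), ?_, ?_⟩
  · refine hU.sum _ (fun i k => (j.choose i : ℝ) * (v i k * w (j - i) k)) fun i hi => ?_
    have hi' : i ≤ j := by simpa [Nat.lt_succ_iff] using hi
    exact hU.mul (IsMod.const _) (hU.mul (hv i hi').1 (hw (j - i) (by omega)).1)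
  · intro k x
    refine (norm_iteratedFDeriv_mul_le (N := (⊤ : ℕ∞)) (hF.1 k) (hG.1 k) x
      (by exact_mod_cast le_top)).trans ?_
    refine Finset.sum_le_sum fun i hi => ?_
    have hi' : i ≤ j := by simpa [Nat.lt_succ_iff] using hi
    have h1 := (hv i hi').2 k x
    have h2 := (hw (j - i) (by omega)).2 k x
    rw [mul_assoc]
    gcongr
    exact (norm_nonneg _).trans h1

theorem Cl.of_const (hU : Cls τ U) {c : ℕ → ℝ} (hc : U (fun k => |c k|)) :
    Cl U n (fun k (_ : E) => c k) := by
  refine ⟨fun k => contDiff_const, fun j _ => ?_⟩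
  rcases j with _ | j
  · exact ⟨_, hc, fun k x => by simp⟩
  · exact ⟨_, hU.zero, fun k x => by
      rw [iteratedFDeriv_const_of_ne (by omega)]; simp⟩

theorem Cl.comp_aff {E' : Type*} [NormedAddCommGroup E'] [NormedSpace ℝ E']
    (hpos : ∀ k, 0 < τ k) (hle : ∀ k, τ k ≤ 1)
    (hU : Cls τ U) (hF : Cl U n F) (L : ℕ → E' →L[ℝ] E) (β : ℕ → E)
    (hL : IsMod τ (fun k => ‖L k‖)) : Cl U n (fun k x => F k (L k x + β k)) := by
  have hs : ∀ k, ContDiff ℝ (⊤ : ℕ∞) (fun y => F k (y + β k)) := fun k =>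
    (hF.1 k).comp (contDiff_id.add contDiff_const)
  refine ⟨fun k => (hs k).comp (L k).contDiff, fun j hj => ?_⟩
  obtain ⟨v, hv, hv'⟩ := hF.2 j hj
  have hpow : ∀ j : ℕ, IsMod τ (fun k => ‖L k‖ ^ j) := by
    intro j
    induction j with
    | zero => simpa using IsMod.const 1
    | succ j ih => simpa [pow_succ] using (cls_mod hpos hle).mul ih hL
  refine ⟨_, hU.mul (hpow j) hv, fun k x => ?_⟩
  have e := (L k).iteratedFDeriv_comp_right (f := fun y => F k (y + β k)) (hs k) x (i := j)
    (by exact_mod_cast le_top)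
  change ‖iteratedFDeriv ℝ j ((fun y => F k (y + β k)) ∘ (L k)) x‖ ≤ _
  rw [e, iteratedFDeriv_comp_add_right]
  refine (ContinuousMultilinearMap.norm_compContinuousLinearMap_le _ _).trans ?_
  rw [Finset.prod_const, Finset.card_univ, Fintype.card_fin, mul_comm]
  gcongr
  exact hv' _ _

theorem Cl.of_deriv {F F' : ℕ → ℝ → ℝ} (hd : ∀ k t, HasDerivAt (F k) (F' k t) t)
    (h0 : Cl U 0 F) (h : Cl U n F') : Cl U (n + 1) F := by
  refine ⟨h0.1, fun j hj => ?_⟩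
  rcases j with _ | j
  · exact h0.2 0 le_rfl
  · obtain ⟨v, hv, hv'⟩ := h.2 j (by omega)
    refine ⟨v, hv, fun k x => ?_⟩
    have e : deriv (F k) = F' k := funext fun t => (hd k t).deriv
    rw [norm_iteratedFDeriv_eq_norm_iteratedDeriv, iteratedDeriv_succ', e,
      ← norm_iteratedFDeriv_eq_norm_iteratedDeriv]
    exact hv' k x

theorem Cl.deriv1 {F F' : ℕ → ℝ → ℝ} (hd : ∀ k t, HasDerivAt (F k) (F' k t) t)
    (h : Cl U (n + 1) F) : Cl U n F' := by
  have e : ∀ k, deriv (F k) = F' k := fun k => funext fun t => (hd k t).deriv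
  refine ⟨fun k => ?_, fun j hj => ?_⟩
  · rw [← e]
    exact (contDiff_infty_iff_deriv.1 (h.1 k)).2
  · obtain ⟨v, hv, hv'⟩ := h.2 (j + 1) (by omega)
    refine ⟨v, hv, fun k x => ?_⟩
    have := hv' k x
    rwa [norm_iteratedFDeriv_eq_norm_iteratedDeriv, iteratedDeriv_succ', e,
      ← norm_iteratedFDeriv_eq_norm_iteratedDeriv] at this

/-- Moderate families. -/
def Md (τ : ℕ → ℝ) (F : ℕ → E → ℝ) : Prop := ∀ n, Cl (IsMod τ) n F

/-- Negligible families. -/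
def Ng (τ : ℕ → ℝ) (F : ℕ → E → ℝ) : Prop := ∀ n, Cl (IsNeg τ) n F

theorem cl_zero {F : ℕ → E → ℝ} (hs : ∀ k, ContDiff ℝ (⊤ : ℕ∞) (F k)) {v : ℕ → ℝ} (hv : U v)
    (h : ∀ k x, |F k x| ≤ v k) : Cl U 0 F := by
  refine ⟨hs, fun j hj => ⟨v, hv, fun k x => ?_⟩⟩
  obtain rfl : j = 0 := by omega
  simpa using h k x

/-- Linear ODE lemma. -/
theorem cl_ode (hU : Cls τ U) {F M : ℕ → ℝ → ℝ} (hd : ∀ k t, HasDerivAt (F k) (M k t * F k t) t)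
    (hM : Md τ M) (h0 : Cl U 0 F) (n : ℕ) : Cl U n F := by
  induction n with
  | zero => exact h0
  | succ n ih => exact Cl.of_deriv hd h0 (Cl.mul hU (hM n) ih)

/-- Riccati ODE lemma. -/
theorem cl_ode2 (hU : Cls τ (IsMod τ)) {F M : ℕ → ℝ → ℝ}
    (hd : ∀ k t, HasDerivAt (F k) (M k t * (F k t * F k t)) t)
    (hM : Md τ M) (h0 : Cl (IsMod τ) 0 F) : Md τ F := by
  intro n
  induction n with
  | zero => exact h0
  | succ n ih => exact Cl.of_deriv hd h0 (Cl.mul hU (hM n) (Cl.mul hU ih ih))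

/-- A function with all derivatives bounded gives a (constant) moderate family. -/
theorem md_fixed {φ : E → ℝ} (hs : ContDiff ℝ (⊤ : ℕ∞) φ)
    (hb : ∀ n, ∃ C, ∀ x, ‖iteratedFDeriv ℝ n φ x‖ ≤ C) : Md τ (fun _ => φ) := by
  intro n
  refine ⟨fun _ => hs, fun j _ => ?_⟩
  obtain ⟨C, hC⟩ := hb j
  exact ⟨fun _ => C, IsMod.const C, fun _ x => hC x⟩

theorem bdd_of_compact {φ : ℝ → ℝ} (hs : ContDiff ℝ (⊤ : ℕ∞) φ) (hc : HasCompactSupport φ)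
    (n : ℕ) : ∃ C, ∀ x, ‖iteratedFDeriv ℝ n φ x‖ ≤ C :=
  (hc.iteratedFDeriv n).exists_bound_of_continuous
    (hs.continuous_iteratedFDeriv (by exact_mod_cast le_top))

theorem bdd_of_deriv_compact {φ : ℝ → ℝ} (hs : ContDiff ℝ (⊤ : ℕ∞) φ)
    (hc : HasCompactSupport (deriv φ)) (hb : ∃ C, ∀ x, |φ x| ≤ C)
    (n : ℕ) : ∃ C, ∀ x, ‖iteratedFDeriv ℝ n φ x‖ ≤ C := by
  rcases n with _ | n
  · simpa using hb
  · obtain ⟨C, hC⟩ := bdd_of_compact (contDiff_infty_iff_deriv.1 hs).2 hc n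
    refine ⟨C, fun x => ?_⟩
    rw [norm_iteratedFDeriv_eq_norm_iteratedDeriv, iteratedDeriv_succ',
      ← norm_iteratedFDeriv_eq_norm_iteratedDeriv]
    exact hC x

theorem bdd_sT (n : ℕ) : ∃ C, ∀ x, ‖iteratedFDeriv ℝ n Real.smoothTransition x‖ ≤ C := by
  refine bdd_of_deriv_compact Real.smoothTransition.contDiff ?_ ⟨1, fun x => ?_⟩ n
  · refine HasCompactSupport.intro (isCompact_Icc (a := (0:ℝ)) (b := 1)) fun x hx => ?_
    rw [mem_Icc, not_and_or, not_le, not_le] at hx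
    rcases hx with hx | hx
    · have : Real.smoothTransition =ᶠ[𝓝 x] fun _ => (0:ℝ) := by
        filter_upwards [gt_mem_nhds hx] with y hy
        exact Real.smoothTransition.zero_of_nonpos hy.le
      rw [this.deriv_eq]; simp
    · have : Real.smoothTransition =ᶠ[𝓝 x] fun _ => (1:ℝ) := by
        filter_upwards [lt_mem_nhds hx] with y hy
        exact Real.smoothTransition.one_of_one_le hy.le
      rw [this.deriv_eq]; simp
  · rw [abs_of_nonneg (Real.smoothTransition.nonneg x)]
    exact Real.smoothTransition.le_one x

theorem bdd_cos_sin (n : ℕ) : (∃ C, ∀ x, ‖iteratedFDeriv ℝ n Real.cos x‖ ≤ C) ∧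
    (∃ C, ∀ x, ‖iteratedFDeriv ℝ n Real.sin x‖ ≤ C) := by
  have : ∀ n, (∀ x, |iteratedDeriv n Real.cos x| ≤ 1) ∧ (∀ x, |iteratedDeriv n Real.sin x| ≤ 1) := by
    intro n
    induction n with
    | zero => simp [Real.abs_cos_le_one, Real.abs_sin_le_one]
    | succ n ih =>
      constructor
      · intro x
        rw [iteratedDeriv_succ', Real.deriv_cos', iteratedDeriv_fun_neg, abs_neg]
        exact ih.2 x
      · intro x
        rw [iteratedDeriv_succ', Real.deriv_sin]
        exact ih.1 x
  constructor
  · exact ⟨1, fun x => by rw [norm_iteratedFDeriv_eq_norm_iteratedDeriv]; exact (this n).1 x⟩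
  · exact ⟨1, fun x => by rw [norm_iteratedFDeriv_eq_norm_iteratedDeriv]; exact (this n).2 x⟩

theorem IsNeg.summable (hs : Summable τ) {v : ℕ → ℝ} (h : IsNeg τ v) : Summable v := by
  obtain ⟨C, h⟩ := h 1
  exact Summable.of_norm_bounded (hs.mul_left C) (fun k => by simpa using h k)

theorem Ng.cinftyB (hs : Summable τ) {F : ℕ → ℝ × ℝ × ℝ → ℝ} (h : Ng τ F) :
    CinftyB (fun p => ∑' k, F k p) := by
  have h1 : ∀ n, ∃ v, IsNeg τ v ∧ ∀ k x, ‖iteratedFDeriv ℝ n (F k) x‖ ≤ v k := fun n =>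
    (h n).2 n le_rfl
  choose v hv hv' using h1
  have hsum : ∀ n, Summable (v n) := fun n => (hv n).summable hs
  refine ⟨contDiff_tsum (h 0).1 (fun n _ => hsum n) (fun n k x _ => hv' n k x), fun n => ?_⟩
  refine ⟨∑' k, v n k, fun p => ?_⟩
  rw [iteratedFDeriv_tsum_apply (N := ⊤) (h 0).1 (fun n _ => hsum n) (fun n k x _ => hv' n k x) le_top]
  exact tsum_of_norm_bounded (hsum n).hasSum fun k => hv' n k p

theorem Ng.hasFDerivAt (hs : Summable τ) {F : ℕ → E → ℝ} (h : Ng τ F) (p : E) :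
    (Summable fun k => fderiv ℝ (F k) p) ∧
    HasFDerivAt (fun p => ∑' k, F k p) (∑' k, fderiv ℝ (F k) p) p := by
  obtain ⟨v, hv, hv'⟩ := (h 1).2 1 le_rfl
  obtain ⟨w, hw, hw'⟩ := (h 1).2 0 (by omega)
  have hb : ∀ k x, ‖fderiv ℝ (F k) x‖ ≤ v k := fun k x => by
    rw [← norm_iteratedFDeriv_one]; exact hv' k x
  refine ⟨Summable.of_norm_bounded (hv.summable hs) fun k => hb k p, ?_⟩
  refine hasFDerivAt_tsum (hv.summable hs) (fun k x => ?_) hb (x₀ := p) ?_ p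
  · exact (((h 0).1 k).differentiable (by simp)).differentiableAt.hasFDerivAt
  · exact Summable.of_norm_bounded (hw.summable hs) fun k => by simpa using hw' k p

theorem Ng.fderiv_tsum (hs : Summable τ) {F : ℕ → E → ℝ} (h : Ng τ F) (p v : E) :
    fderiv ℝ (fun p => ∑' k, F k p) p v = ∑' k, fderiv ℝ (F k) p v := by
  obtain ⟨h1, h2⟩ := h.hasFDerivAt hs p
  rw [h2.fderiv]
  exact (ContinuousLinearMap.apply ℝ ℝ v).map_tsum h1

end

end Plis

namespace Plis
open Real Set Filter Topology

/-! ### The sequence of time steps and the building blocks -/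

structure TD (τ : ℕ → ℝ) : Prop where
  pos : ∀ k, 0 < τ k
  le8 : ∀ k, τ k ≤ 1 / 8
  anti : ∀ k, τ (k + 1) ≤ τ k
  low : ∀ k, 99 / 100 * τ k ≤ τ (k + 1)
  summ : Summable τ

noncomputable section

/-- switching times -/
def T (τ : ℕ → ℝ) (k : ℕ) : ℝ := ∑' j, τ (j + k)

/-- rescaled time on the `k`-th interval `[T (k+1), T k]` -/
def S (τ : ℕ → ℝ) (k : ℕ) (t : ℝ) : ℝ := (t - T τ (k + 1)) / τ k

/-- frequencies -/
def xi (τ : ℕ → ℝ) (k : ℕ) : ℝ := (τ k)⁻¹ ^ 2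

/-- squared frequencies -/
def zz (τ : ℕ → ℝ) (k : ℕ) : ℝ := (τ k)⁻¹ ^ 4

def chi (s : ℝ) : ℝ := Real.smoothTransition (8 * s - 1)

def psi (s : ℝ) : ℝ := Real.smoothTransition (8 * s) * Real.smoothTransition (8 * (1 - s))

/-- amplitude of the oscillation of `l` on the `k`-th interval -/
def del (τ : ℕ → ℝ) (k : ℕ) : ℝ :=
  if Even k then -((2 * (τ k)⁻¹ ^ 2 + zz τ (k + 1) - zz τ k) / zz τ (k + 1))
  else (2 * (τ k)⁻¹ ^ 2 + zz τ (k + 1) - zz τ k) / zz τ k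

def ff (τ : ℕ → ℝ) (k : ℕ) (t : ℝ) : ℝ := del τ k * psi (S τ k t)

def mm (τ : ℕ → ℝ) (k : ℕ) (t : ℝ) : ℝ := if Even k then 1 else 1 + ff τ k t + ff τ (k - 1) t

def cut (τ : ℕ → ℝ) : ℕ → ℝ → ℝ
  | 0, t => Real.smoothTransition (1 - (t - T τ 0))
  | k + 1, t => Real.smoothTransition (8 * (1 - S τ k t))

def rate (τ : ℕ → ℝ) (k : ℕ) (t : ℝ) : ℝ := zz τ k * (mm τ k t * cut τ k t)

def cen (τ : ℕ → ℝ) (k : ℕ) : ℝ := T τ (k + 1) + τ k / 2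

def En (τ : ℕ → ℝ) : ℕ → ℝ
  | 0 => zz τ 0 * τ 0
  | k + 1 => En τ k + ∫ s in (cen τ (k + 1))..(cen τ k), rate τ (k + 1) s

def th (τ : ℕ → ℝ) (k : ℕ) (t : ℝ) : ℝ := -En τ k + ∫ s in (cen τ k)..t, rate τ k s

def dn (τ : ℕ → ℝ) : ℕ → ℝ → ℝ
  | 0, _ => 1
  | k + 1, t => chi (1 - S τ k t)

def ww (τ : ℕ → ℝ) (k : ℕ) (t : ℝ) : ℝ := chi (S τ k t) * dn τ k t

def dn' (τ : ℕ → ℝ) : ℕ → ℝ → ℝ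
  | 0, _ => 0
  | k + 1, t => -(deriv chi (1 - S τ k t) / τ k)

def ww' (τ : ℕ → ℝ) (k : ℕ) (t : ℝ) : ℝ :=
  deriv chi (S τ k t) / τ k * dn τ k t + chi (S τ k t) * dn' τ k t

def amp (τ : ℕ → ℝ) (k : ℕ) (t : ℝ) : ℝ := ww τ k t * Real.exp (th τ k t)

def yb (s : ℝ) : ℝ :=
  (2 * s - 1 / 2) * (Real.smoothTransition (8 * s) * Real.smoothTransition (3 - 8 * s))

/-- `Y`, equal to `exp (Λ (2 s - 1))` for `s ∈ [1/8, 1/4]`. -/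
def YY (Λ s : ℝ) : ℝ := Real.exp (Λ * (-1 / 2 + yb s))

def hh (Λ s : ℝ) : ℝ := (1 - (chi s * YY Λ s) * (chi s * YY Λ s))⁻¹

def qq (Λ s : ℝ) : ℝ := deriv chi s * (hh Λ s * YY Λ s)

def pp (Λ s : ℝ) : ℝ := chi s * YY Λ s * qq Λ s

def kap (τ : ℕ → ℝ) (k : ℕ) (t : ℝ) : ℝ :=
  (τ k)⁻¹ * (qq (τ k)⁻¹ (S τ k t) + -1 * qq (τ k)⁻¹ (1 - S τ k t))

def zet (τ : ℕ → ℝ) (k : ℕ) (t : ℝ) : ℝ :=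
  (τ k)⁻¹ * (pp (τ k)⁻¹ (S τ k t) + -1 * pp (τ k)⁻¹ (1 - S τ k t))

end

theorem chi_contDiff : ContDiff ℝ (⊤ : ℕ∞) chi :=
  Real.smoothTransition.contDiff.comp ((contDiff_const.mul contDiff_id).sub contDiff_const)

theorem chi_nonneg (s : ℝ) : 0 ≤ chi s := Real.smoothTransition.nonneg _
theorem chi_le_one (s : ℝ) : chi s ≤ 1 := Real.smoothTransition.le_one _
theorem chi_zero {s : ℝ} (h : s ≤ 1 / 8) : chi s = 0 :=
  Real.smoothTransition.zero_of_nonpos (by linarith)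
theorem chi_one {s : ℝ} (h : 1 / 4 ≤ s) : chi s = 1 :=
  Real.smoothTransition.one_of_one_le (by linarith)
theorem chi_pos {s : ℝ} (h : 1 / 8 < s) : 0 < chi s :=
  Real.smoothTransition.pos_of_pos (by linarith)

theorem dchi_lt {s : ℝ} (h : s < 1 / 8) : deriv chi s = 0 := by
  have : chi =ᶠ[𝓝 s] fun _ => (0:ℝ) := by
    filter_upwards [gt_mem_nhds h] with y hy
    exact chi_zero hy.le
  rw [this.deriv_eq]; simp

theorem dchi_gt {s : ℝ} (h : 1 / 4 < s) : deriv chi s = 0 := by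
  have : chi =ᶠ[𝓝 s] fun _ => (1:ℝ) := by
    filter_upwards [lt_mem_nhds h] with y hy
    exact chi_one hy.le
  rw [this.deriv_eq]; simp

theorem chi_hasDerivAt (s : ℝ) : HasDerivAt chi (deriv chi s) s :=
  ((chi_contDiff.differentiable (by simp)) s).hasDerivAt

theorem dchi_contDiff : ContDiff ℝ (⊤ : ℕ∞) (deriv chi) := (contDiff_infty_iff_deriv.1 chi_contDiff).2

theorem dchi_compact : HasCompactSupport (deriv chi) := by
  refine HasCompactSupport.intro (isCompact_Icc (a := (1/8:ℝ)) (b := 1/4)) fun x hx => ?_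
  rw [mem_Icc, not_and_or, not_le, not_le] at hx
  rcases hx with hx | hx
  · exact dchi_lt hx
  · exact dchi_gt hx

theorem bdd_chi (n : ℕ) : ∃ C, ∀ x, ‖iteratedFDeriv ℝ n chi x‖ ≤ C :=
  bdd_of_deriv_compact chi_contDiff dchi_compact
    ⟨1, fun x => by rw [abs_of_nonneg (chi_nonneg x)]; exact chi_le_one x⟩ n

theorem psi_contDiff : ContDiff ℝ (⊤ : ℕ∞) psi :=
  (Real.smoothTransition.contDiff.comp (contDiff_const.mul contDiff_id)).mul
    (Real.smoothTransition.contDiff.comp (contDiff_const.mul (contDiff_const.sub contDiff_id)))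

theorem psi_left {s : ℝ} (h : s ≤ 0) : psi s = 0 := by
  simp [psi, Real.smoothTransition.zero_of_nonpos (show 8 * s ≤ 0 by linarith)]
theorem psi_right {s : ℝ} (h : 1 ≤ s) : psi s = 0 := by
  simp [psi, Real.smoothTransition.zero_of_nonpos (show 8 * (1 - s) ≤ 0 by linarith)]
theorem psi_mid {s : ℝ} (h : 1 / 8 ≤ s) (h' : s ≤ 7 / 8) : psi s = 1 := by
  simp only [psi, Real.smoothTransition.one_of_one_le (show 1 ≤ 8 * s by linarith),
    Real.smoothTransition.one_of_one_le (show 1 ≤ 8 * (1 - s) by linarith), mul_one]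
theorem psi_nonneg (s : ℝ) : 0 ≤ psi s :=
  mul_nonneg (Real.smoothTransition.nonneg _) (Real.smoothTransition.nonneg _)
theorem psi_le_one (s : ℝ) : psi s ≤ 1 :=
  mul_le_one₀ (Real.smoothTransition.le_one _) (Real.smoothTransition.nonneg _)
    (Real.smoothTransition.le_one _)

theorem psi_compact : HasCompactSupport psi := by
  refine HasCompactSupport.intro (isCompact_Icc (a := (0:ℝ)) (b := 1)) fun x hx => ?_
  rw [mem_Icc, not_and_or, not_le, not_le] at hx
  rcases hx with hx | hx
  · exact psi_left hx.le
  · exact psi_right hx.le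

theorem yb_contDiff : ContDiff ℝ (⊤ : ℕ∞) yb :=
  ((contDiff_const.mul contDiff_id).sub contDiff_const).mul
    ((Real.smoothTransition.contDiff.comp (contDiff_const.mul contDiff_id)).mul
    (Real.smoothTransition.contDiff.comp (contDiff_const.sub (contDiff_const.mul contDiff_id))))

theorem yb_compact : HasCompactSupport yb := by
  refine HasCompactSupport.intro (isCompact_Icc (a := (0:ℝ)) (b := 3/8)) fun x hx => ?_
  rw [mem_Icc, not_and_or, not_le, not_le] at hx
  rcases hx with hx | hx
  · simp [yb, Real.smoothTransition.zero_of_nonpos (show 8 * x ≤ 0 by linarith)]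
  · simp [yb, Real.smoothTransition.zero_of_nonpos (show 3 - 8 * x ≤ 0 by linarith)]

theorem yb_mid {s : ℝ} (h : 1 / 8 ≤ s) (h' : s ≤ 1 / 4) : yb s = 2 * s - 1 / 2 := by
  simp only [yb, Real.smoothTransition.one_of_one_le (show 1 ≤ 8 * s by linarith),
    Real.smoothTransition.one_of_one_le (show 1 ≤ 3 - 8 * s by linarith), mul_one]

theorem yb_le (s : ℝ) : yb s ≤ 1 / 4 := by
  have h0 := Real.smoothTransition.nonneg (8 * s)
  have h1 := Real.smoothTransition.le_one (8 * s)
  have h2 := Real.smoothTransition.nonneg (3 - 8 * s)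
  have h3 := Real.smoothTransition.le_one (3 - 8 * s)
  rcases le_or_gt s (3 / 8) with hs | hs
  · have h4 : Real.smoothTransition (8 * s) * Real.smoothTransition (3 - 8 * s) ≤ 1 :=
      mul_le_one₀ h1 h2 h3
    have h5 := mul_nonneg h0 h2
    unfold yb
    nlinarith
  · simp only [yb, Real.smoothTransition.zero_of_nonpos (show 3 - 8 * s ≤ 0 by linarith)]
    norm_num

section
variable {τ : ℕ → ℝ}

theorem TD.le1 (hτ : TD τ) (k : ℕ) : τ k ≤ 1 := (hτ.le8 k).trans (by norm_num)
theorem TD.clsM (hτ : TD τ) : Cls τ (IsMod τ) := cls_mod hτ.pos hτ.le1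
theorem TD.clsN (hτ : TD τ) : Cls τ (IsNeg τ) := cls_neg hτ.pos
theorem TD.inv_mono (hτ : TD τ) (k : ℕ) : (τ k)⁻¹ ≤ (τ (k + 1))⁻¹ :=
  inv_anti₀ (hτ.pos _) (hτ.anti k)
theorem TD.inv_up (hτ : TD τ) (k : ℕ) : (τ (k + 1))⁻¹ ≤ 100 / 99 * (τ k)⁻¹ := by
  have h := inv_anti₀ (by have := hτ.pos k; positivity) (hτ.low k)
  rw [mul_inv] at h
  norm_num at h ⊢
  exact h
theorem TD.inv_ge (hτ : TD τ) (k : ℕ) : 8 ≤ (τ k)⁻¹ := by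
  rw [le_inv_comm₀ (by norm_num) (hτ.pos k)]
  simpa using hτ.le8 k

theorem TD.mul (hτ : TD τ) {E : Type*} [NormedAddCommGroup E] [NormedSpace ℝ E] {F G : ℕ → E → ℝ}
    (hF : Md τ F) (hG : Md τ G) : Md τ (fun k x => F k x * G k x) :=
  fun n => Cl.mul hτ.clsM (hF n) (hG n)
theorem TD.add (hτ : TD τ) {E : Type*} [NormedAddCommGroup E] [NormedSpace ℝ E] {F G : ℕ → E → ℝ}
    (hF : Md τ F) (hG : Md τ G) : Md τ (fun k x => F k x + G k x) :=
  fun n => Cl.add hτ.clsM (hF n) (hG n)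
theorem TD.nmul (hτ : TD τ) {E : Type*} [NormedAddCommGroup E] [NormedSpace ℝ E] {F G : ℕ → E → ℝ}
    (hF : Md τ F) (hG : Ng τ G) : Ng τ (fun k x => F k x * G k x) :=
  fun n => Cl.mul hτ.clsN (hF n) (hG n)
theorem TD.nadd (hτ : TD τ) {E : Type*} [NormedAddCommGroup E] [NormedSpace ℝ E] {F G : ℕ → E → ℝ}
    (hF : Ng τ F) (hG : Ng τ G) : Ng τ (fun k x => F k x + G k x) :=
  fun n => Cl.add hτ.clsN (hF n) (hG n)
theorem TD.con (hτ : TD τ) {E : Type*} [NormedAddCommGroup E] [NormedSpace ℝ E] {c : ℕ → ℝ}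
    (hc : IsMod τ c) : Md τ (fun k (_ : E) => c k) :=
  fun _ => Cl.of_const hτ.clsM (hc.mono fun k => by simp)

theorem neg_mod (hτ : TD τ) {v : ℕ → ℝ} (h : IsNeg τ v) : IsMod τ v := by
  obtain ⟨C, h⟩ := h 0
  exact ⟨C, 0, by simpa using h⟩

theorem Ng.md (hτ : TD τ) {E : Type*} [NormedAddCommGroup E] [NormedSpace ℝ E] {F : ℕ → E → ℝ}
    (hF : Ng τ F) : Md τ F := fun n => ⟨(hF n).1, fun j hj => by
  obtain ⟨v, hv, h⟩ := (hF n).2 j hj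
  exact ⟨v, neg_mod hτ hv, h⟩⟩

theorem md_aff (hτ : TD τ) {φ : ℝ → ℝ} (hs : ContDiff ℝ (⊤ : ℕ∞) φ)
    (hb : ∀ n, ∃ C, ∀ x, ‖iteratedFDeriv ℝ n φ x‖ ≤ C) {A : ℕ → ℝ → ℝ} (α β : ℕ → ℝ)
    (hA : ∀ k t, A k t = α k * t + β k) (hα : IsMod τ α) : Md τ (fun k t => φ (A k t)) := by
  intro n
  have := Cl.comp_aff (n := n) hτ.pos hτ.le1 hτ.clsM (md_fixed hs hb n)
    (fun k => ContinuousLinearMap.toSpanSingleton ℝ (α k)) β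
    (by simpa [ContinuousLinearMap.norm_toSpanSingleton] using hα.mono (fun k => by simp))
  convert this using 4 with k t
  rw [hA]; simp [mul_comm]

theorem neg_exp (hτ : TD τ) (c : ℝ) (hc : 0 < c) : IsNeg τ (fun k => Real.exp (-(c * (τ k)⁻¹))) := by
  intro N
  refine ⟨N.factorial / c ^ N, fun k => ?_⟩
  have hk := hτ.pos k
  rw [abs_of_pos (Real.exp_pos _), Real.exp_neg]
  have h := Real.pow_div_factorial_le_exp (c * (τ k)⁻¹) (by positivity) N
  have hpos : 0 < (c * (τ k)⁻¹) ^ N / (N.factorial : ℝ) := by positivity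
  refine (inv_anti₀ hpos h).trans (le_of_eq ?_)
  rw [inv_div, mul_pow, inv_pow]
  field_simp

/-! Class of affine time changes -/

theorem mod_inv (hτ : TD τ) : IsMod τ (fun k => (τ k)⁻¹) := by simpa using isMod_inv hτ.pos 1

theorem mod_shift (hτ : TD τ) {v : ℕ → ℝ} (h : IsMod τ v) : IsMod τ (fun k => v (k - 1)) := by
  obtain ⟨C, N, h⟩ := h
  refine ⟨C, N, fun k => ?_⟩
  have hC := nonneg_of_bound hτ.pos h
  refine (h (k - 1)).trans ?_
  have h1 : (τ (k - 1))⁻¹ ≤ (τ k)⁻¹ := by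
    rcases k with _ | k
    · simp
    · simpa using hτ.inv_mono k
  have := hτ.pos (k - 1)
  gcongr

/-- families `φ (S k t)`, `φ (1 - S k t)` and shifted versions -/
theorem md_S (hτ : TD τ) {φ : ℝ → ℝ} (hs : ContDiff ℝ (⊤ : ℕ∞) φ)
    (hb : ∀ n, ∃ C, ∀ x, ‖iteratedFDeriv ℝ n φ x‖ ≤ C) : Md τ (fun k t => φ (S τ k t)) :=
  md_aff hτ hs hb (fun k => (τ k)⁻¹) (fun k => -T τ (k + 1) / τ k)
    (fun k t => by unfold S; ring) (mod_inv hτ)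

theorem md_S1 (hτ : TD τ) {φ : ℝ → ℝ} (hs : ContDiff ℝ (⊤ : ℕ∞) φ)
    (hb : ∀ n, ∃ C, ∀ x, ‖iteratedFDeriv ℝ n φ x‖ ≤ C) : Md τ (fun k t => φ (1 - S τ k t)) :=
  md_aff hτ hs hb (fun k => -(τ k)⁻¹) (fun k => 1 + T τ (k + 1) / τ k)
    (fun k t => by unfold S; ring) ((mod_inv hτ).mono fun k => by simp)

theorem md_Sm (hτ : TD τ) {φ : ℝ → ℝ} (hs : ContDiff ℝ (⊤ : ℕ∞) φ)
    (hb : ∀ n, ∃ C, ∀ x, ‖iteratedFDeriv ℝ n φ x‖ ≤ C) : Md τ (fun k t => φ (S τ (k - 1) t)) :=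
  md_aff hτ hs hb (fun k => (τ (k - 1))⁻¹) (fun k => -T τ (k - 1 + 1) / τ (k - 1))
    (fun k t => by unfold S; ring) (mod_shift hτ (mod_inv hτ))

theorem md_cut (hτ : TD τ) : Md τ (cut τ) := by
  have : Md τ (fun k t => Real.smoothTransition (
      (fun k => match k with | 0 => -1 | k + 1 => -8 * (τ k)⁻¹ : ℕ → ℝ) k * t +
      (fun k => match k with
        | 0 => 1 + T τ 0 | k + 1 => 8 * (1 + T τ (k + 1) / τ k) : ℕ → ℝ) k)) := by
    refine md_aff hτ Real.smoothTransition.contDiff bdd_sT _ _ (fun k t => rfl) ?_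
    refine ((hτ.clsM.mul (IsMod.const 8) (mod_inv hτ)).mono fun k => ?_)
    rcases k with _ | k
    · have := hτ.inv_ge 0
      simp only [abs_neg, abs_one]
      rw [abs_of_nonneg (by positivity)]; linarith
    · have := hτ.inv_mono k
      have h0 := hτ.inv_ge k
      simp only [abs_mul, abs_neg]
      rw [abs_of_nonneg (show (0:ℝ) ≤ (τ k)⁻¹ by linarith),
        abs_of_nonneg (show (0:ℝ) ≤ (τ (k+1))⁻¹ by linarith)]
      gcongr
  convert this using 3 with k t
  rcases k with _ | k
  · simp only [cut]; congr 1; ring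
  · simp only [cut, S]; congr 1; ring

theorem md_dn (hτ : TD τ) : Md τ (dn τ) := by
  have : Md τ (fun k t => chi (
      (fun k => match k with | 0 => 0 | k + 1 => -(τ k)⁻¹ : ℕ → ℝ) k * t +
      (fun k => match k with
        | 0 => 1 | k + 1 => (1 + T τ (k + 1) / τ k) : ℕ → ℝ) k)) := by
    refine md_aff hτ chi_contDiff bdd_chi _ _ (fun k t => rfl) ?_
    refine ((mod_inv hτ).mono fun k => ?_)
    rcases k with _ | k
    · simp
    · have := hτ.inv_mono k
      have h0 := hτ.inv_ge k
      simp only [abs_neg]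
      rw [abs_of_nonneg (show (0:ℝ) ≤ (τ k)⁻¹ by linarith),
        abs_of_nonneg (show (0:ℝ) ≤ (τ (k+1))⁻¹ by linarith)]
      exact this
  convert this using 3 with k t
  rcases k with _ | k
  · simp only [dn]; rw [chi_one (by norm_num)]
  · simp only [dn, S]; congr 1; ring

theorem zz_pos (hτ : TD τ) (k : ℕ) : 0 < zz τ k := by have := hτ.pos k; unfold zz; positivity

theorem zz_mono (hτ : TD τ) (k : ℕ) : zz τ k ≤ zz τ (k + 1) := by
  have := hτ.inv_mono k
  have h0 := hτ.inv_ge k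
  unfold zz; gcongr

theorem zz_up (hτ : TD τ) (k : ℕ) : zz τ (k + 1) ≤ 521 / 500 * zz τ k := by
  have := hτ.inv_up k
  have h0 := hτ.inv_ge k
  have h1 := hτ.inv_ge (k + 1)
  unfold zz
  calc (τ (k+1))⁻¹ ^ 4 ≤ (100 / 99 * (τ k)⁻¹) ^ 4 := by gcongr
    _ = (100 / 99) ^ 4 * (τ k)⁻¹ ^ 4 := by ring
    _ ≤ _ := by gcongr; norm_num

theorem del_abs (hτ : TD τ) (k : ℕ) : |del τ k| ≤ (2 * (τ k)⁻¹ ^ 2 + zz τ (k + 1) - zz τ k) / zz τ k := by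
  have h1 := zz_mono hτ k
  have h2 := zz_pos hτ k
  have h3 := zz_pos hτ (k + 1)
  have h4 : 0 ≤ 2 * (τ k)⁻¹ ^ 2 + zz τ (k + 1) - zz τ k := by
    have := hτ.pos k
    have : 0 ≤ (τ k)⁻¹ ^ 2 := by positivity
    linarith
  unfold del
  split_ifs
  · rw [abs_neg, abs_of_nonneg (by positivity)]
    gcongr
  · rw [abs_of_nonneg (by positivity)]

theorem del_le (hτ : TD τ) (k : ℕ) : |del τ k| ≤ 3 / 40 := by
  refine (del_abs hτ k).trans ?_
  rw [div_le_iff₀ (zz_pos hτ k)]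
  have h1 := zz_up hτ k
  have h0 := hτ.inv_ge k
  have h2 : 64 * (τ k)⁻¹ ^ 2 ≤ zz τ k := by
    unfold zz
    have h3 : 64 ≤ (τ k)⁻¹ ^ 2 := by nlinarith
    calc 64 * (τ k)⁻¹ ^ 2 ≤ (τ k)⁻¹ ^ 2 * (τ k)⁻¹ ^ 2 := by gcongr
      _ = _ := by ring
  have h4 := zz_pos hτ k
  linarith

theorem ff_abs (hτ : TD τ) (k : ℕ) (t : ℝ) : |ff τ k t| ≤ 3 / 40 := by
  unfold ff
  rw [abs_mul, abs_of_nonneg (psi_nonneg _)]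
  calc _ ≤ (3 / 40 : ℝ) * 1 := by
        gcongr
        · exact psi_nonneg _
        · exact del_le hτ k
        · exact psi_le_one _
    _ = _ := by ring

theorem mm_bd (hτ : TD τ) (k : ℕ) (t : ℝ) : 0.85 ≤ mm τ k t ∧ mm τ k t ≤ 1.15 := by
  unfold mm
  split_ifs
  · norm_num
  · have h1 := abs_le.1 (ff_abs hτ k t)
    have h2 := abs_le.1 (ff_abs hτ (k - 1) t)
    constructor <;> linarith [h1.1, h1.2, h2.1, h2.2]

theorem md_mm (hτ : TD τ) : Md τ (mm τ) := by
  have hdel : IsMod τ (del τ) := (IsMod.const 1).mono fun k => by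
    rw [abs_one]; exact (del_le hτ k).trans (by norm_num)
  have h1 : Md τ (ff τ) :=
    hτ.mul (hτ.con hdel) (md_S hτ psi_contDiff (bdd_of_compact psi_contDiff psi_compact))
  have h2 : Md τ (fun k t => ff τ (k - 1) t) :=
    hτ.mul (hτ.con (mod_shift hτ hdel))
      (md_Sm hτ psi_contDiff (bdd_of_compact psi_contDiff psi_compact))
  have hc : IsMod τ (fun k => if Even k then (0:ℝ) else 1) := (IsMod.const 1).mono fun k => by
    split_ifs <;> simp
  have h3 := hτ.add (hτ.con (E := ℝ) (IsMod.const 1)) (hτ.mul (hτ.con hc) (hτ.add h1 h2))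
  convert h3 using 3 with k t
  unfold mm
  split_ifs
  · ring
  · ring

theorem mod_zz (hτ : TD τ) : IsMod τ (zz τ) := isMod_inv hτ.pos 4

theorem md_rate (hτ : TD τ) : Md τ (rate τ) :=
  hτ.mul (hτ.con (mod_zz hτ)) (hτ.mul (md_mm hτ) (md_cut hτ))

theorem rate_contDiff (hτ : TD τ) (k : ℕ) : ContDiff ℝ (⊤ : ℕ∞) (rate τ k) := (md_rate hτ 0).1 k

theorem th_hasDerivAt (hτ : TD τ) (k : ℕ) (t : ℝ) : HasDerivAt (th τ k) (rate τ k t) t :=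
  (intervalIntegral.integral_hasDerivAt_right
    ((rate_contDiff hτ k).continuous.intervalIntegrable _ _)
    ((rate_contDiff hτ k).continuous.stronglyMeasurableAtFilter _ _)
    (rate_contDiff hτ k).continuous.continuousAt).const_add _

theorem th_contDiff (hτ : TD τ) (k : ℕ) : ContDiff ℝ (⊤ : ℕ∞) (th τ k) := by
  rw [contDiff_infty_iff_deriv]
  refine ⟨fun t => (th_hasDerivAt hτ k t).differentiableAt, ?_⟩
  rw [show deriv (th τ k) = rate τ k from funext fun t => (th_hasDerivAt hτ k t).deriv]
  exact rate_contDiff hτ k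

/-- `YY`, `hh`, `qq`, `pp` along a family of affine maps -/
theorem ng_qp (hτ : TD τ) (A : ℕ → ℝ → ℝ) (α β : ℕ → ℝ)
    (hA : ∀ k t, A k t = α k * t + β k) (hα : IsMod τ α) :
    Ng τ (fun k t => qq (τ k)⁻¹ (A k t)) ∧ Ng τ (fun k t => pp (τ k)⁻¹ (A k t)) := by
  have hAd : ∀ k t, HasDerivAt (A k) (α k) t := fun k t => by
    have : A k = fun t => α k * t + β k := funext (hA k)
    rw [this]
    simpa using ((hasDerivAt_id t).const_mul (α k)).add_const (β k)
  have hchi := md_aff hτ chi_contDiff bdd_chi α β hA hα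
  have hdchi := md_aff hτ dchi_contDiff (bdd_of_compact dchi_contDiff dchi_compact) α β hA hα
  have hyb := md_aff hτ yb_contDiff (bdd_of_compact yb_contDiff yb_compact) α β hA hα
  have hAs : ∀ k, ContDiff ℝ (⊤ : ℕ∞) (A k) := fun k => by
    have : A k = fun t => α k * t + β k := funext (hA k)
    rw [this]
    exact (contDiff_const.mul contDiff_id).add contDiff_const
  -- Y
  have hdyb : ∀ k t, HasDerivAt (fun t => yb (A k t)) (deriv yb (A k t) * α k) t := fun k t =>
    (((yb_contDiff.differentiable (by simp)) (A k t)).hasDerivAt).comp t (hAd k t)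
  have hdyb' : Md τ (fun k t => deriv yb (A k t) * α k) := fun n => Cl.deriv1 hdyb (hyb (n + 1))
  have hYs : ∀ k, ContDiff ℝ (⊤ : ℕ∞) (fun t => YY (τ k)⁻¹ (A k t)) := fun k =>
    (contDiff_const.mul (contDiff_const.add (yb_contDiff.comp (hAs k)))).exp
  have hYle : ∀ k s, YY (τ k)⁻¹ s ≤ Real.exp (-(1 / 4 * (τ k)⁻¹)) := fun k s => by
    unfold YY
    apply Real.exp_le_exp.2
    have h0 := hτ.inv_ge k
    nlinarith [yb_le s]
  have hY : Ng τ (fun k t => YY (τ k)⁻¹ (A k t)) := by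
    refine cl_ode hτ.clsN (M := fun k t => (τ k)⁻¹ * (deriv yb (A k t) * α k)) ?_
      (hτ.mul (hτ.con (mod_inv hτ)) hdyb') ?_
    · intro k t
      have := (((hdyb k t).const_add (-1 / 2)).const_mul (τ k)⁻¹).exp
      unfold YY
      convert this using 1
      ring
    · refine cl_zero hYs (neg_exp hτ (1 / 4) (by norm_num)) fun k x => ?_
      rw [abs_of_pos (show 0 < YY _ _ from Real.exp_pos _)]
      exact hYle k _
  -- chi * Y
  have hcY : Ng τ (fun k t => chi (A k t) * YY (τ k)⁻¹ (A k t)) := hτ.nmul hchi hY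
  have hcYb : ∀ k s, 0 ≤ chi s * YY (τ k)⁻¹ s ∧ chi s * YY (τ k)⁻¹ s ≤ 1 / 2 := fun k s => by
    have hYp : 0 < YY (τ k)⁻¹ s := Real.exp_pos _
    refine ⟨mul_nonneg (chi_nonneg s) hYp.le, ?_⟩
    have h1 : YY (τ k)⁻¹ s ≤ 1 / 2 := by
      refine (hYle k s).trans ?_
      have h0 := hτ.inv_ge k
      rw [Real.exp_neg, show (1 / 2 : ℝ) = 2⁻¹ by norm_num]
      apply inv_anti₀ (by norm_num)
      linarith [Real.add_one_le_exp (1 / 4 * (τ k)⁻¹)]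
    nlinarith [chi_nonneg s, chi_le_one s]
  have hsq : Md τ (fun k t => (chi (A k t) * YY (τ k)⁻¹ (A k t)) * (chi (A k t) * YY (τ k)⁻¹ (A k t))) :=
    (Ng.md hτ (hτ.nmul (Ng.md hτ hcY) hcY))
  have hden : ∀ k s, 1 / 2 ≤ 1 - (chi s * YY (τ k)⁻¹ s) * (chi s * YY (τ k)⁻¹ s) := fun k s => by
    nlinarith [(hcYb k s).1, (hcYb k s).2]
  have hdsq : ∀ k t, HasDerivAt
      (fun t => (chi (A k t) * YY (τ k)⁻¹ (A k t)) * (chi (A k t) * YY (τ k)⁻¹ (A k t)))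
      (deriv (fun t => (chi (A k t) * YY (τ k)⁻¹ (A k t)) * (chi (A k t) * YY (τ k)⁻¹ (A k t))) t)
      t := fun k t => ((((hsq 0).1 k).differentiable (by simp)) t).hasDerivAt
  have hh1 : Md τ (fun k t => hh (τ k)⁻¹ (A k t)) := by
    refine cl_ode2 hτ.clsM (M := fun k => deriv (fun t => (chi (A k t) * YY (τ k)⁻¹ (A k t)) *
      (chi (A k t) * YY (τ k)⁻¹ (A k t)))) ?_ (fun n => Cl.deriv1 hdsq (hsq (n + 1))) ?_
    · intro k t
      have hne : 1 - (chi (A k t) * YY (τ k)⁻¹ (A k t)) * (chi (A k t) * YY (τ k)⁻¹ (A k t)) ≠ 0 := by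
        have := hden k (A k t); linarith
      have := ((hdsq k t).const_sub 1).inv hne
      unfold hh
      refine this.congr_deriv ?_
      rw [neg_neg, div_eq_mul_inv, ← inv_pow, sq]
    · refine cl_zero (fun k => ?_) (IsMod.const 2) fun k x => ?_
      · refine (contDiff_const.sub ((hsq 0).1 k)).inv fun t => ?_
        have := hden k (A k t); linarith
      · unfold hh
        have := hden k (A k x)
        rw [abs_of_nonneg (by positivity)]
        rw [inv_le_comm₀ (by linarith) (by norm_num)]
        linarith
  have hq : Ng τ (fun k t => qq (τ k)⁻¹ (A k t)) := hτ.nmul hdchi (hτ.nmul hh1 hY)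
  exact ⟨hq, hτ.nmul (Ng.md hτ hcY) hq⟩

theorem ng_kap (hτ : TD τ) : Ng τ (kap τ) ∧ Ng τ (zet τ) := by
  obtain ⟨h1, h2⟩ := ng_qp hτ (S τ) (fun k => (τ k)⁻¹) (fun k => -T τ (k + 1) / τ k)
    (fun k t => by unfold S; ring) (mod_inv hτ)
  obtain ⟨h3, h4⟩ := ng_qp hτ (fun k t => 1 - S τ k t) (fun k => -(τ k)⁻¹)
    (fun k => 1 + T τ (k + 1) / τ k)
    (fun k t => by unfold S; ring) ((mod_inv hτ).mono fun k => by simp)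
  have hc := hτ.con (E := ℝ) (IsMod.const (τ := τ) (-1))
  exact ⟨hτ.nmul (hτ.con (mod_inv hτ)) (hτ.nadd h1 (hτ.nmul hc h3)),
    hτ.nmul (hτ.con (mod_inv hτ)) (hτ.nadd h2 (hτ.nmul hc h4))⟩

end
end Plis

namespace Plis
open Real Set Filter Topology

set_option linter.unusedSectionVars false

noncomputable section

/-- the coefficient `l` -/
def ll (τ : ℕ → ℝ) (t : ℝ) : ℝ := 1 + ∑' k, ff τ k t

def ctop (τ : ℕ → ℝ) (t : ℝ) : ℝ := zz τ 0 * (1 - cut τ 0 t)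

/-- `t` is located in the `k`-th interval -/
def Loc (τ : ℕ → ℝ) (k : ℕ) (t : ℝ) : Prop :=
  (∀ j < k, S τ j t ≤ 0) ∧ (∀ j > k, 1 ≤ S τ j t)

end

section
variable {τ : ℕ → ℝ}

theorem T_succ (hτ : TD τ) (k : ℕ) : T τ k = τ k + T τ (k + 1) := by
  unfold T
  have hs : Summable (fun j => τ (j + k)) := (summable_nat_add_iff k).2 hτ.summ
  rw [hs.tsum_eq_zero_add]
  simp only [zero_add]
  congr 1
  exact tsum_congr fun j => by congr 1; omega

theorem T_anti (hτ : TD τ) : Antitone (T τ) :=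
  antitone_nat_of_succ_le fun k => by rw [T_succ hτ k]; linarith [hτ.pos k]

theorem T_tendsto (hτ : TD τ) : Tendsto (T τ) atTop (𝓝 0) := tendsto_sum_nat_add τ

theorem T_pos (hτ : TD τ) (k : ℕ) : 0 < T τ k := by
  rw [T_succ hτ k]
  have h : 0 ≤ T τ (k + 1) := tsum_nonneg fun j => (hτ.pos _).le
  linarith [hτ.pos k]

theorem S_nonpos (hτ : TD τ) {k : ℕ} {t : ℝ} : S τ k t ≤ 0 ↔ t ≤ T τ (k + 1) := by
  unfold S
  rw [div_le_iff₀ (hτ.pos k)]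
  constructor <;> intro h <;> linarith

theorem one_le_S (hτ : TD τ) {k : ℕ} {t : ℝ} : 1 ≤ S τ k t ↔ T τ k ≤ t := by
  unfold S
  rw [le_div_iff₀ (hτ.pos k), T_succ hτ k]
  constructor <;> intro h <;> linarith

theorem S_mono (hτ : TD τ) (k : ℕ) : Monotone (S τ k) := fun a b h => by
  unfold S
  have := hτ.pos k
  gcongr

theorem S_cen (hτ : TD τ) (k : ℕ) : S τ k (cen τ k) = 1 / 2 := by
  unfold S cen
  have := (hτ.pos k).ne'
  field_simp
  ring

theorem exists_loc (hτ : TD τ) {t : ℝ} (ht : 0 < t) : ∃ k, Loc τ k t := by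
  have h1 : ∃ n, T τ (n + 1) ≤ t := by
    have := ((tendsto_add_atTop_iff_nat 1).2 (T_tendsto hτ)).eventually (gt_mem_nhds ht)
    obtain ⟨n, hn⟩ := this.exists
    exact ⟨n, hn.le⟩
  classical
  refine ⟨Nat.find h1, fun j hj => ?_, fun j hj => ?_⟩
  · exact (S_nonpos hτ).2 (not_le.1 (Nat.find_min h1 hj)).le
  · exact (one_le_S hτ).2 ((T_anti hτ hj).trans (Nat.find_spec h1))

theorem S_neg (hτ : TD τ) {t : ℝ} (ht : t ≤ 0) (k : ℕ) : S τ k t ≤ 0 :=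
  (S_nonpos hτ).2 (ht.trans (T_pos hτ _).le)

end

section
variable {τ : ℕ → ℝ} {k : ℕ} {t : ℝ}

theorem left_zero (h : S τ k t ≤ 0) : amp τ k t = 0 ∧ ww' τ k t = 0 ∧ kap τ k t = 0 ∧
    zet τ k t = 0 ∧ ff τ k t = 0 := by
  have h1 : chi (S τ k t) = 0 := chi_zero (by linarith)
  have h2 : deriv chi (S τ k t) = 0 := dchi_lt (by linarith)
  have h3 : deriv chi (1 - S τ k t) = 0 := dchi_gt (by linarith)
  refine ⟨by simp [amp, ww, h1], by simp [ww', h1, h2], by simp [kap, qq, h2, h3],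
    by simp [zet, pp, qq, h2, h3], by simp [ff, psi_left h]⟩

theorem right_zero (h : 1 ≤ S τ k t) : amp τ (k + 1) t = 0 ∧ ww' τ (k + 1) t = 0 ∧ kap τ k t = 0 ∧
    zet τ k t = 0 ∧ ff τ k t = 0 := by
  have h1 : chi (1 - S τ k t) = 0 := chi_zero (by linarith)
  have h2 : deriv chi (S τ k t) = 0 := dchi_gt (by linarith)
  have h3 : deriv chi (1 - S τ k t) = 0 := dchi_lt (by linarith)
  refine ⟨by simp [amp, ww, dn, h1], by simp [ww', dn, dn', h1, h3], by simp [kap, qq, h2, h3],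
    by simp [zet, pp, qq, h2, h3], by simp [ff, psi_right h]⟩

theorem Loc.amp_zero (h : Loc τ k t) {j : ℕ} (h1 : j ≠ k) (h2 : j ≠ k + 1) :
    amp τ j t = 0 ∧ ww' τ j t = 0 := by
  rcases lt_or_gt_of_ne h1 with hj | hj
  · have := left_zero (h.1 j hj); exact ⟨this.1, this.2.1⟩
  · obtain ⟨m, rfl⟩ : ∃ m, j = m + 1 := ⟨j - 1, by omega⟩
    have := right_zero (h.2 m (by omega)); exact ⟨this.1, this.2.1⟩

theorem Loc.kap_zero (h : Loc τ k t) {j : ℕ} (h1 : j ≠ k) :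
    kap τ j t = 0 ∧ zet τ j t = 0 ∧ ff τ j t = 0 := by
  rcases lt_or_gt_of_ne h1 with hj | hj
  · have := left_zero (h.1 j hj); exact this.2.2
  · have := right_zero (h.2 j (by omega)); exact this.2.2

theorem Loc.ll_eq (h : Loc τ k t) : ll τ t = 1 + ff τ k t := by
  unfold ll
  rw [tsum_eq_single k fun j hj => (h.kap_zero hj).2.2]

theorem Loc.dn_eq (h : Loc τ k t) : dn τ k t = 1 ∧ dn' τ k t = 0 := by
  rcases k with _ | m
  · simp [dn, dn']
  · have := h.1 m (by omega)
    simp [dn, dn', chi_one (show 1 / 4 ≤ 1 - S τ m t by linarith),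
      dchi_gt (show 1 / 4 < 1 - S τ m t by linarith)]

theorem Loc.ww_eq (h : Loc τ k t) : ww τ k t = chi (S τ k t) ∧
    ww' τ k t = deriv chi (S τ k t) / τ k ∧ ww τ (k + 1) t = chi (1 - S τ k t) ∧
    ww' τ (k + 1) t = -(deriv chi (1 - S τ k t) / τ k) := by
  have h1 := h.2 (k + 1) (by omega)
  have h2 : chi (S τ (k + 1) t) = 1 := chi_one (by linarith)
  have h3 : deriv chi (S τ (k + 1) t) = 0 := dchi_gt (by linarith)
  refine ⟨by simp [ww, h.dn_eq.1], by simp [ww', h.dn_eq.1, h.dn_eq.2], by simp [ww, h2, dn],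
    by simp [ww', h2, h3, dn']⟩

end

section
variable {τ : ℕ → ℝ}

theorem cut_nonneg (hτ : TD τ) (k : ℕ) (t : ℝ) : 0 ≤ cut τ k t ∧ cut τ k t ≤ 1 := by
  rcases k with _ | k
  · exact ⟨Real.smoothTransition.nonneg _, Real.smoothTransition.le_one _⟩
  · exact ⟨Real.smoothTransition.nonneg _, Real.smoothTransition.le_one _⟩

theorem cut_one (hτ : TD τ) {k : ℕ} {t : ℝ} (h : S τ k t ≤ 7 / 8) : cut τ (k + 1) t = 1 :=
  Real.smoothTransition.one_of_one_le (by linarith)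

theorem cut_zero_one (hτ : TD τ) {t : ℝ} (h : t ≤ T τ 0) : cut τ 0 t = 1 :=
  Real.smoothTransition.one_of_one_le (by linarith)

theorem rate_nonneg (hτ : TD τ) (k : ℕ) (t : ℝ) : 0 ≤ rate τ k t := by
  have h1 := (mm_bd hτ k t).1
  have h2 := (cut_nonneg hτ k t).1
  have h3 := zz_pos hτ k
  have h4 : 0 ≤ mm τ k t := le_trans (by norm_num) h1
  unfold rate; positivity

theorem rate_le (hτ : TD τ) (k : ℕ) (t : ℝ) : rate τ k t ≤ 23 / 20 * zz τ k := by
  have h1 := (mm_bd hτ k t)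
  have h2 := (cut_nonneg hτ k t)
  have h3 := zz_pos hτ k
  have h4 : 0 ≤ mm τ k t := le_trans (by norm_num) h1.1
  unfold rate
  have h5 : mm τ k t * cut τ k t ≤ 23 / 20 * 1 := by
    gcongr
    · exact h2.1
    · exact h1.2.trans (by norm_num)
    · exact h2.2
  nlinarith

theorem rate_int (hτ : TD τ) (k : ℕ) (a b : ℝ) : IntervalIntegrable (rate τ k) MeasureTheory.volume a b :=
  (rate_contDiff hτ k).continuous.intervalIntegrable _ _

theorem th_sub (hτ : TD τ) (k : ℕ) (a b : ℝ) : th τ k b = th τ k a + ∫ s in a..b, rate τ k s := by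
  unfold th
  rw [add_assoc, intervalIntegral.integral_add_adjacent_intervals (rate_int hτ _ _ _) (rate_int hτ _ _ _)]

theorem th_cen (hτ : TD τ) (k : ℕ) : th τ k (cen τ k) = -En τ k := by simp [th]

theorem th_cen' (hτ : TD τ) (k : ℕ) : th τ (k + 1) (cen τ k) = -En τ k := by
  simp [th, En]

theorem th_mono (hτ : TD τ) (k : ℕ) : Monotone (th τ k) := by
  refine monotone_of_deriv_nonneg (fun t => (th_hasDerivAt hτ k t).differentiableAt) fun t => ?_
  rw [(th_hasDerivAt hτ k t).deriv]; exact rate_nonneg hτ k t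

theorem th_le (hτ : TD τ) {k : ℕ} {a : ℝ} (h : ∀ r, a ≤ r → rate τ k r = 0) (t : ℝ) : th τ k t ≤ th τ k a := by
  rcases le_total t a with h1 | h1
  · exact th_mono hτ k h1
  · rw [th_sub hτ k a t]
    rw [intervalIntegral.integral_congr (g := fun _ => (0:ℝ))]
    · simp
    · intro r hr
      rw [uIcc_of_le h1] at hr
      exact h r hr.1

theorem En_ge (hτ : TD τ) (k : ℕ) : 0 ≤ En τ k ∧ 17 / 20 * (zz τ k * τ k) ≤ En τ k := by
  induction k with
  | zero =>
    have h1 := zz_pos hτ 0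
    have h2 := hτ.pos 0
    have : 0 < zz τ 0 * τ 0 := by positivity
    simp only [En]
    constructor <;> linarith
  | succ k ih =>
    have hc : cen τ (k + 1) + τ (k + 1) ≤ cen τ k := by
      unfold cen
      rw [T_succ hτ (k + 1)]
      linarith [hτ.anti k]
    have hp := hτ.pos (k + 1)
    have hz := zz_pos hτ (k + 1)
    have : 17 / 20 * (zz τ (k + 1) * τ (k + 1)) ≤
        ∫ s in (cen τ (k + 1))..(cen τ k), rate τ (k + 1) s := by
      have h1 : ∫ s in (cen τ (k + 1))..(cen τ k), (17 / 20 * zz τ (k + 1)) ≤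
          ∫ s in (cen τ (k + 1))..(cen τ k), rate τ (k + 1) s := by
        refine intervalIntegral.integral_mono_on (by linarith) (by simp) (rate_int hτ _ _ _)
          fun r hr => ?_
        unfold rate
        have h2 : S τ k r ≤ 1 / 2 := by rw [← S_cen hτ k]; exact S_mono hτ k hr.2
        rw [cut_one hτ (by linarith)]
        have := (mm_bd hτ (k + 1) r).1
        norm_num at this
        nlinarith
      refine le_trans ?_ h1
      simp only [intervalIntegral.integral_const, smul_eq_mul]
      have : τ (k + 1) ≤ cen τ k - cen τ (k + 1) := by linarith
      calc _ = τ (k + 1) * (17 / 20 * zz τ (k + 1)) := by ring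
        _ ≤ _ := by gcongr
    simp only [En]
    have h2 : 0 < zz τ (k + 1) * τ (k + 1) := by positivity
    constructor <;> linarith [ih.1]

theorem th_bound_succ (hτ : TD τ) (k : ℕ) (t : ℝ) : th τ (k + 1) t ≤ -(1 / 2 * (τ (k + 1))⁻¹) := by
  have h0 := hτ.pos k
  have hle := hτ.le8 k
  refine (th_le hτ (a := T τ k) (fun r hr => ?_) t).trans ?_
  · unfold rate
    have h1 := (one_le_S hτ).2 hr
    have : cut τ (k + 1) r = 0 := Real.smoothTransition.zero_of_nonpos (by linarith)
    simp [this]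
  · rw [th_sub hτ (k + 1) (cen τ k), th_cen' hτ]
    have hT : T τ k = cen τ k + τ k / 2 := by unfold cen; rw [T_succ hτ k]; ring
    have h1 : ∫ s in (cen τ k)..(T τ k), rate τ (k + 1) s ≤
        ∫ s in (cen τ k)..(T τ k), (23 / 20 * zz τ (k + 1)) :=
      intervalIntegral.integral_mono_on (by linarith) (rate_int hτ _ _ _) (by simp)
        fun r hr => rate_le hτ _ r
    simp only [intervalIntegral.integral_const, smul_eq_mul] at h1
    rw [show T τ k - cen τ k = τ k / 2 by linarith] at h1
    have h2 := (En_ge hτ k).2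
    have h3 := zz_up hτ k
    have h4 : (8:ℝ) ≤ (τ k)⁻¹ := hτ.inv_ge k
    have h5 := hτ.inv_up k
    have h6 : zz τ k * τ k = (τ k)⁻¹ ^ 3 := by
      unfold zz; field_simp
    have h7 : zz τ (k + 1) * τ k ≤ 521 / 500 * (zz τ k * τ k) := by nlinarith
    have h8 : 64 * (τ k)⁻¹ ≤ (τ k)⁻¹ ^ 3 := by
      have : 64 ≤ (τ k)⁻¹ ^ 2 := by nlinarith
      calc 64 * (τ k)⁻¹ ≤ (τ k)⁻¹ ^ 2 * (τ k)⁻¹ := by gcongr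
        _ = _ := by ring
    rw [h6] at h2 h7
    have h9 : τ k / 2 * (23 / 20 * zz τ (k + 1)) = 23 / 40 * (zz τ (k + 1) * τ k) := by ring
    rw [h9] at h1
    have h10 : -(1 / 2 * (100 / 99 * (τ k)⁻¹)) ≤ -(1 / 2 * (τ (k + 1))⁻¹) := by linarith
    refine le_trans ?_ h10
    generalize (∫ s in (cen τ k)..(T τ k), rate τ (k + 1) s) = I at *
    generalize zz τ (k + 1) * τ k = Z at *
    generalize (τ k)⁻¹ ^ 3 = X at *
    linarith

theorem th_bound (hτ : TD τ) : ∃ C, ∀ k t, th τ k t ≤ C + -(1 / 2 * (τ k)⁻¹) := by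
  refine ⟨|th τ 0 (T τ 0 + 1)| + 1 / 2 * (τ 0)⁻¹, fun k t => ?_⟩
  rcases k with _ | k
  · have := th_le hτ (k := 0) (a := T τ 0 + 1) (fun r hr => ?_) t
    · linarith [le_abs_self (th τ 0 (T τ 0 + 1))]
    · have : cut τ 0 r = 0 := Real.smoothTransition.zero_of_nonpos (by linarith)
      simp [rate, this]
  · have := th_bound_succ hτ k t
    have h4 : (8:ℝ) ≤ (τ 0)⁻¹ := hτ.inv_ge 0
    linarith [abs_nonneg (th τ 0 (T τ 0 + 1))]

theorem ng_exp (hτ : TD τ) : Ng τ (fun k t => Real.exp (th τ k t)) := by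
  obtain ⟨C, hC⟩ := th_bound hτ
  refine cl_ode hτ.clsN (M := rate τ) (fun k t => ?_) (md_rate hτ) ?_
  · have := (th_hasDerivAt hτ k t).exp
    rwa [mul_comm] at this
  · refine cl_zero (fun k => (th_contDiff hτ k).exp)
      (hτ.clsN.mul (IsMod.const (Real.exp C)) (neg_exp hτ (1 / 2) (by norm_num))) fun k t => ?_
    rw [abs_of_pos (Real.exp_pos _), ← Real.exp_add]
    exact Real.exp_le_exp.2 (hC k t)

theorem ng_amp (hτ : TD τ) : Ng τ (amp τ) :=
  hτ.nmul (hτ.mul (md_S hτ chi_contDiff bdd_chi) (md_dn hτ)) (ng_exp hτ)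

theorem S_hasDerivAt (hτ : TD τ) (k : ℕ) (t : ℝ) : HasDerivAt (S τ k) (1 / τ k) t :=
  ((hasDerivAt_id t).sub_const _).div_const _

theorem ww_hasDerivAt (hτ : TD τ) (k : ℕ) (t : ℝ) : HasDerivAt (ww τ k) (ww' τ k t) t := by
  have h1 : HasDerivAt (fun t => chi (S τ k t)) (deriv chi (S τ k t) / τ k) t :=
    ((chi_hasDerivAt _).comp t (S_hasDerivAt hτ k t)).congr_deriv (by ring)
  have h2 : HasDerivAt (dn τ k) (dn' τ k t) t := by
    rcases k with _ | k
    · exact hasDerivAt_const _ _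
    · exact ((chi_hasDerivAt _).comp t ((S_hasDerivAt hτ k t).const_sub 1)).congr_deriv
        (by simp only [dn']; ring)
  exact h1.mul h2

theorem amp_hasDerivAt (hτ : TD τ) (k : ℕ) (t : ℝ) : HasDerivAt (amp τ k)
    (ww' τ k t * Real.exp (th τ k t) + rate τ k t * amp τ k t) t :=
  ((ww_hasDerivAt hτ k t).mul (th_hasDerivAt hτ k t).exp).congr_deriv (by unfold amp; ring)

theorem Loc.ctop_zero (hτ : TD τ) {k : ℕ} {t : ℝ} (h : t ≤ T τ k) : ctop τ t = 0 := by
  unfold ctop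
  rw [cut_zero_one hτ (h.trans (T_anti hτ (Nat.zero_le k)))]
  ring

theorem Loc.rate_eq (hτ : TD τ) {k : ℕ} {t : ℝ} (h : Loc τ k t) (j : ℕ) :
    rate τ j t * amp τ j t =
      (zz τ j * (if Even j then 1 else ll τ t) - ctop τ t) * amp τ j t := by
  by_cases h1 : j = k
  · subst h1
    congr 1
    rcases j with _ | m
    · simp only [rate, mm, ctop]
      simp; ring
    · have hS := h.1 m (by omega)
      have h3 : t ≤ T τ (m + 1) := (S_nonpos hτ).1 hS
      rw [Loc.ctop_zero hτ h3, h.ll_eq]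
      simp only [rate, mm]
      rw [cut_one hτ (by linarith)]
      simp only [Nat.add_sub_cancel, (h.kap_zero (show m ≠ m + 1 by omega)).2.2]
      simp
  · by_cases h2 : j = k + 1
    · subst h2
      rcases le_or_gt (7 / 8) (S τ k t) with h3 | h3
      · have : amp τ (k + 1) t = 0 := by
          simp [amp, h.ww_eq.2.2.1, chi_zero (show 1 - S τ k t ≤ 1 / 8 by linarith)]
        simp [this]
      · congr 1
        have h4 : t ≤ T τ k := by
          by_contra h5
          have := (one_le_S hτ).2 (not_le.1 h5).le
          linarith
        rw [Loc.ctop_zero hτ h4, h.ll_eq]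
        simp only [rate, mm]
        rw [cut_one hτ h3.le]
        simp only [Nat.add_sub_cancel, (h.kap_zero (show k + 1 ≠ k by omega)).2.2]
        simp
    · rw [(h.amp_zero h1 h2).1]; simp

/-- difference of the rates on the plateau -/
theorem rate_diff (hτ : TD τ) {k : ℕ} {t : ℝ} (h1 : 1 / 8 ≤ S τ k t) (h2 : S τ k t ≤ 7 / 8) :
    rate τ k t = rate τ (k + 1) t + 2 * (τ k)⁻¹ ^ 2 := by
  have hT1 : T τ (k + 1) ≤ t := by
    by_contra h; have := (S_nonpos hτ).2 (not_le.1 h).le; linarith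
  have hT2 : t ≤ T τ k := by
    by_contra h; have := (one_le_S hτ).2 (not_le.1 h).le; linarith
  have hk : Loc τ k t := by
    refine ⟨fun j hj => (S_nonpos hτ).2 (hT2.trans (T_anti hτ hj)),
      fun j hj => (one_le_S hτ).2 ((T_anti hτ hj).trans hT1)⟩
  have hck : cut τ k t = 1 := by
    rcases k with _ | m
    · exact cut_zero_one hτ hT2
    · exact cut_one hτ (by linarith [hk.1 m (by omega)])
  have hf : ff τ k t = del τ k := by rw [ff, psi_mid h1 h2, mul_one]
  have hz := (zz_pos hτ k).ne'
  have hz' := (zz_pos hτ (k + 1)).ne'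
  unfold rate
  rw [hck, cut_one hτ h2]
  by_cases he : Even k
  · have ho : ¬ Even (k + 1) := by rw [Nat.even_add_one]; simpa using he
    simp only [mm, he, ho, if_true, if_false, Nat.add_sub_cancel, hf,
      (hk.kap_zero (show k + 1 ≠ k by omega)).2.2, del]
    field_simp
    ring
  · have ho : Even (k + 1) := by rw [Nat.even_add_one]; simpa using he
    have hk1 : k - 1 ≠ k := by
      rcases k with _ | m
      · simp at he
      · omega
    simp only [mm, he, ho, if_true, if_false, hf, (hk.kap_zero hk1).2.2, del]
    field_simp
    ring

theorem th_diff (hτ : TD τ) {k : ℕ} {t : ℝ} (h1 : 1 / 8 ≤ S τ k t) (h2 : S τ k t ≤ 7 / 8) :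
    th τ k t = th τ (k + 1) t + (τ k)⁻¹ * (2 * S τ k t - 1) := by
  rw [th_sub hτ k (cen τ k), th_sub hτ (k + 1) (cen τ k) t, th_cen hτ, th_cen' hτ]
  have hc := S_cen hτ k
  rw [intervalIntegral.integral_congr (g := fun r => rate τ (k + 1) r + 2 * (τ k)⁻¹ ^ 2)]
  · rw [intervalIntegral.integral_add (rate_int hτ _ _ _) (by simp)]
    simp only [intervalIntegral.integral_const, smul_eq_mul]
    have hk := (hτ.pos k).ne'
    unfold cen S
    field_simp
    ring
  · intro r hr
    apply rate_diff hτ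
    · rcases le_total (cen τ k) t with h | h
      · rw [uIcc_of_le h] at hr
        have := S_mono hτ k hr.1; linarith
      · rw [uIcc_of_ge h] at hr
        have := S_mono hτ k hr.1; linarith
    · rcases le_total (cen τ k) t with h | h
      · rw [uIcc_of_le h] at hr
        have := S_mono hτ k hr.2; linarith
      · rw [uIcc_of_ge h] at hr
        have := S_mono hτ k hr.2; linarith

theorem hh_ne (hτ : TD τ) {Λ s : ℝ} (hΛ : 8 ≤ Λ) : 1 - (chi s * YY Λ s) * (chi s * YY Λ s) ≠ 0 := by
  have h1 : YY Λ s < 1 := by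
    unfold YY
    rw [Real.exp_lt_one_iff]
    have := yb_le s
    nlinarith
  have h2 : 0 < YY Λ s := Real.exp_pos _
  have h3 := chi_nonneg s
  have h4 := chi_le_one s
  have h5 : chi s * YY Λ s < 1 := by nlinarith
  have h6 : 0 ≤ chi s * YY Λ s := by positivity
  nlinarith

/-- the algebraic identities of the transition -/
theorem Loc.ident (hτ : TD τ) {k : ℕ} {t : ℝ} (h : Loc τ k t) :
    ww' τ k t * Real.exp (th τ k t) = kap τ k t * amp τ (k + 1) t - zet τ k t * amp τ k t ∧
    ww' τ (k + 1) t * Real.exp (th τ (k + 1) t) =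
      kap τ k t * amp τ k t - zet τ k t * amp τ (k + 1) t := by
  have hk := (hτ.pos k).ne'
  obtain ⟨e1, e2, e3, e4⟩ := h.ww_eq
  unfold amp kap zet
  rw [e1, e2, e3, e4]
  set s := S τ k t with hs
  have key : ∀ r, qq (τ k)⁻¹ r - pp (τ k)⁻¹ r * chi r * YY (τ k)⁻¹ r =
      deriv chi r * YY (τ k)⁻¹ r := by
    intro r
    have := hh_ne hτ (s := r) (hτ.inv_ge k)
    have h2 : (1 - (chi r * YY (τ k)⁻¹ r) * (chi r * YY (τ k)⁻¹ r)) * hh (τ k)⁻¹ r = 1 :=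
      mul_inv_cancel₀ this
    unfold pp qq
    linear_combination (deriv chi r * YY (τ k)⁻¹ r) * h2
  by_cases hA : 1 / 8 ≤ s ∧ s ≤ 1 / 4
  · obtain ⟨h1, h2⟩ := hA
    have hY : Real.exp (th τ k t) = Real.exp (th τ (k + 1) t) * YY (τ k)⁻¹ s := by
      rw [th_diff hτ (by linarith) (by linarith), Real.exp_add]
      unfold YY
      rw [yb_mid h1 h2]
      congr 2; ring
    have hd : deriv chi (1 - s) = 0 := dchi_gt (by linarith)
    have hc : chi (1 - s) = 1 := chi_one (by linarith)
    have hq : qq (τ k)⁻¹ (1 - s) = 0 := by simp [qq, hd]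
    have hp : pp (τ k)⁻¹ (1 - s) = 0 := by simp [pp, hq]
    rw [hd, hc, hq, hp, hY]
    constructor
    · linear_combination (-(τ k)⁻¹ * Real.exp (th τ (k + 1) t)) * key s
    · unfold pp; ring
  · by_cases hB : 1 / 8 ≤ 1 - s ∧ 1 - s ≤ 1 / 4
    · obtain ⟨h1, h2⟩ := hB
      have hY : Real.exp (th τ (k + 1) t) = Real.exp (th τ k t) * YY (τ k)⁻¹ (1 - s) := by
        rw [th_diff hτ (k := k) (by linarith) (by linarith), Real.exp_add]
        unfold YY
        rw [yb_mid h1 h2, mul_assoc, ← Real.exp_add]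
        rw [show (τ k)⁻¹ * (2 * S τ k t - 1) + (τ k)⁻¹ * (-1 / 2 + (2 * (1 - s) - 1 / 2)) = 0 by
          rw [hs]; ring]
        simp
      have hd : deriv chi s = 0 := dchi_gt (by linarith)
      have hc : chi s = 1 := chi_one (by linarith)
      have hq : qq (τ k)⁻¹ s = 0 := by simp [qq, hd]
      have hp : pp (τ k)⁻¹ s = 0 := by simp [pp, hq]
      rw [hd, hc, hq, hp, hY]
      constructor
      · unfold pp; ring
      · linear_combination ((τ k)⁻¹ * Real.exp (th τ k t)) * key (1 - s)
    · have z : ∀ r, ¬ (1 / 8 ≤ r ∧ r ≤ 1 / 4) → deriv chi r = 0 := fun r hr => by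
        rw [not_and_or, not_le, not_le] at hr
        rcases hr with hr | hr
        · exact dchi_lt hr
        · exact dchi_gt hr
      have z1 := z _ hA
      have z2 := z _ hB
      simp [pp, qq, z1, z2]

end
end Plis

namespace Plis
open Real Set Filter Topology

/-! ### The solution in three variables -/

set_option linter.unusedSectionVars false

noncomputable section

def XL (k : ℕ) : ℝ × ℝ × ℝ →L[ℝ] ℝ :=
  if Even k then (ContinuousLinearMap.fst ℝ ℝ ℝ).comp (ContinuousLinearMap.snd ℝ ℝ (ℝ × ℝ))
  else (ContinuousLinearMap.snd ℝ ℝ ℝ).comp (ContinuousLinearMap.snd ℝ ℝ (ℝ × ℝ))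

def ex (k : ℕ) (v : ℝ × ℝ × ℝ) : ℝ := XL k v

def co (τ : ℕ → ℝ) (k : ℕ) (p : ℝ × ℝ × ℝ) : ℝ := Real.cos (xi τ k * XL k p)
def si (τ : ℕ → ℝ) (k : ℕ) (p : ℝ × ℝ × ℝ) : ℝ := Real.sin (xi τ k * XL k p)

def F0 (τ : ℕ → ℝ) (k : ℕ) (p : ℝ × ℝ × ℝ) : ℝ := co τ k p * amp τ k p.1
def F1 (τ : ℕ → ℝ) (v : ℝ × ℝ × ℝ) (k : ℕ) (p : ℝ × ℝ × ℝ) : ℝ :=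
  (-(xi τ k * ex k v)) * (si τ k p * amp τ k p.1)

def uu (τ : ℕ → ℝ) (p : ℝ × ℝ × ℝ) : ℝ := ∑' k, F0 τ k p

def BL (τ : ℕ → ℝ) (k : ℕ) (p : ℝ × ℝ × ℝ) : ℝ :=
  (xi τ k)⁻¹ * (co τ (k + 1) p * (si τ k p * kap τ k p.1))
def BH (τ : ℕ → ℝ) (k : ℕ) (p : ℝ × ℝ × ℝ) : ℝ :=
  (xi τ (k + 1))⁻¹ * (co τ k p * (si τ (k + 1) p * kap τ k p.1))

def b1 (τ : ℕ → ℝ) (p : ℝ × ℝ × ℝ) : ℝ :=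
  ∑' k, (ex k (0, 1, 0) * BL τ k p + ex k (0, 0, 1) * BH τ k p)
def b2 (τ : ℕ → ℝ) (p : ℝ × ℝ × ℝ) : ℝ :=
  ∑' k, (ex k (0, 0, 1) * BL τ k p + ex k (0, 1, 0) * BH τ k p)
def cc (τ : ℕ → ℝ) (p : ℝ × ℝ × ℝ) : ℝ :=
  ctop τ p.1 + ∑' k, (-1 * (co τ k p * (co τ (k + 1) p * kap τ k p.1)) + zet τ k p.1)

end

theorem ex_even {k : ℕ} (h : Even k) (v : ℝ × ℝ × ℝ) : ex k v = v.2.1 := by simp [ex, XL, h]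
theorem ex_odd {k : ℕ} (h : ¬ Even k) (v : ℝ × ℝ × ℝ) : ex k v = v.2.2 := by simp [ex, XL, h]

theorem XL_norm (k : ℕ) : ‖XL k‖ ≤ 1 := by
  refine ContinuousLinearMap.opNorm_le_bound _ zero_le_one fun p => ?_
  rw [one_mul]
  by_cases h : Even k
  · simp only [XL, h, if_true]
    exact (norm_fst_le p.2).trans (norm_snd_le p)
  · simp only [XL, h, if_false]
    exact (norm_snd_le p.2).trans (norm_snd_le p)

section
variable {τ : ℕ → ℝ}

theorem cl_lift (hτ : TD τ) {U : (ℕ → ℝ) → Prop} (hU : Cls τ U) {n : ℕ} {F : ℕ → ℝ → ℝ} (h : Cl U n F) :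
    Cl U n (fun k (p : ℝ × ℝ × ℝ) => F k p.1) := by
  have := Cl.comp_aff hτ.pos hτ.le1 hU h (fun _ => ContinuousLinearMap.fst ℝ ℝ (ℝ × ℝ)) (fun _ => 0)
    (IsMod.const _)
  simpa using this

theorem md_lift (hτ : TD τ) {F : ℕ → ℝ → ℝ} (h : Md τ F) : Md τ (fun k (p : ℝ × ℝ × ℝ) => F k p.1) :=
  fun n => cl_lift hτ hτ.clsM (h n)

theorem ng_lift (hτ : TD τ) {F : ℕ → ℝ → ℝ} (h : Ng τ F) : Ng τ (fun k (p : ℝ × ℝ × ℝ) => F k p.1) :=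
  fun n => cl_lift hτ hτ.clsN (h n)

theorem md_trig (hτ : TD τ) {φ : ℝ → ℝ} (hs : ContDiff ℝ (⊤ : ℕ∞) φ)
    (hb : ∀ n, ∃ C, ∀ x, ‖iteratedFDeriv ℝ n φ x‖ ≤ C) {a : ℕ → ℝ} (ha : IsMod τ a) (i : ℕ → ℕ) :
    Md τ (fun k p => φ (a k * XL (i k) p)) := by
  intro n
  have := Cl.comp_aff (n := n) hτ.pos hτ.le1 hτ.clsM (md_fixed hs hb n)
    (fun k => a k • XL (i k)) (fun _ => 0) (ha.mono fun k => by
      rw [norm_smul, Real.norm_eq_abs, abs_mul, abs_abs, abs_norm]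
      exact mul_le_of_le_one_right (abs_nonneg _) (XL_norm _))
  simpa using this

theorem xi_pos (hτ : TD τ) (k : ℕ) : 0 < xi τ k := by have := hτ.pos k; unfold xi; positivity

theorem xi_ge (hτ : TD τ) (k : ℕ) : 1 ≤ xi τ k := by
  have := hτ.inv_ge k
  unfold xi
  nlinarith

theorem zz_eq (hτ : TD τ) (k : ℕ) : zz τ k = xi τ k ^ 2 := by unfold zz xi; ring

theorem mod_xi (hτ : TD τ) : IsMod τ (xi τ) := isMod_inv hτ.pos 2

theorem mod_xi1 (hτ : TD τ) : IsMod τ (fun k => xi τ (k + 1)) := by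
  refine (hτ.clsM.mul (IsMod.const ((100 / 99) ^ 2)) (mod_xi hτ)).mono fun k => ?_
  have h1 := hτ.inv_up k
  have h2 := xi_pos hτ (k + 1)
  have h3 := xi_pos hτ k
  have h4 := hτ.pos (k + 1)
  rw [abs_of_pos h2, abs_of_pos (by positivity)]
  unfold xi
  rw [← mul_pow]
  gcongr

theorem mod_xi_inv (hτ : TD τ) : IsMod τ (fun k => (xi τ k)⁻¹) := (IsMod.const 1).mono fun k => by
  have h3 := xi_pos hτ k
  rw [abs_of_pos (by positivity), abs_one]
  exact inv_le_one_of_one_le₀ (xi_ge hτ k)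

theorem mod_xi1_inv (hτ : TD τ) : IsMod τ (fun k => (xi τ (k + 1))⁻¹) := (IsMod.const 1).mono fun k => by
  have h3 := xi_pos hτ (k + 1)
  rw [abs_of_pos (by positivity), abs_one]
  exact inv_le_one_of_one_le₀ (xi_ge hτ (k + 1))

theorem mod_ex (hτ : TD τ) (v : ℝ × ℝ × ℝ) : IsMod τ (fun k => ex k v) := (IsMod.const ‖v‖).mono fun k => by
  rw [abs_norm, ← Real.norm_eq_abs]
  refine ((XL k).le_opNorm v).trans ?_
  exact mul_le_of_le_one_left (norm_nonneg _) (XL_norm k)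

theorem md_co (hτ : TD τ) : Md τ (co τ) := md_trig hτ Real.contDiff_cos (fun n => (bdd_cos_sin n).1) (mod_xi hτ) id
theorem md_si (hτ : TD τ) : Md τ (si τ) := md_trig hτ Real.contDiff_sin (fun n => (bdd_cos_sin n).2) (mod_xi hτ) id
theorem md_co1 (hτ : TD τ) : Md τ (fun k => co τ (k + 1)) :=
  md_trig hτ Real.contDiff_cos (fun n => (bdd_cos_sin n).1) (mod_xi1 hτ) (fun k => k + 1)
theorem md_si1 (hτ : TD τ) : Md τ (fun k => si τ (k + 1)) :=
  md_trig hτ Real.contDiff_sin (fun n => (bdd_cos_sin n).2) (mod_xi1 hτ) (fun k => k + 1)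

theorem ng_F0 (hτ : TD τ) : Ng τ (F0 τ) := hτ.nmul (md_co hτ) (ng_lift hτ (ng_amp hτ))

theorem ng_F1 (hτ : TD τ) (v : ℝ × ℝ × ℝ) : Ng τ (F1 τ v) := by
  refine hτ.nmul (hτ.con ((hτ.clsM.mul (mod_xi hτ) (mod_ex hτ v)).mono fun k => by simp)) ?_
  exact hτ.nmul (md_si hτ) (ng_lift hτ (ng_amp hτ))

theorem ng_BL (hτ : TD τ) : Ng τ (BL τ) := hτ.nmul (hτ.con (mod_xi_inv hτ))
  (hτ.nmul (md_co1 hτ) (hτ.nmul (md_si hτ) (ng_lift hτ (ng_kap hτ).1)))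

theorem ng_BH (hτ : TD τ) : Ng τ (BH τ) := hτ.nmul (hτ.con (mod_xi1_inv hτ))
  (hτ.nmul (md_co hτ) (hτ.nmul (md_si1 hτ) (ng_lift hτ (ng_kap hτ).1)))

theorem uu_CB (hτ : TD τ) : CinftyB (uu τ) := (ng_F0 hτ).cinftyB hτ.summ

theorem b1_CB (hτ : TD τ) : CinftyB (b1 τ) :=
  Ng.cinftyB hτ.summ (hτ.nadd (hτ.nmul (hτ.con (mod_ex hτ _)) (ng_BL hτ))
    (hτ.nmul (hτ.con (mod_ex hτ _)) (ng_BH hτ)))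

theorem b2_CB (hτ : TD τ) : CinftyB (b2 τ) :=
  Ng.cinftyB hτ.summ (hτ.nadd (hτ.nmul (hτ.con (mod_ex hτ _)) (ng_BL hτ))
    (hτ.nmul (hτ.con (mod_ex hτ _)) (ng_BH hτ)))

theorem cb_of_md (hτ : TD τ) {F : ℕ → ℝ × ℝ × ℝ → ℝ} (h : Md τ F) (k : ℕ) : CinftyB (F k) :=
  ⟨(h 0).1 k, fun n => by
    obtain ⟨v, _, hv⟩ := (h n).2 n le_rfl
    exact ⟨v k, hv k⟩⟩

theorem cb_add (hτ : TD τ) {f g : ℝ × ℝ × ℝ → ℝ} (hf : CinftyB f) (hg : CinftyB g) :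
    CinftyB (fun p => f p + g p) :=
  cb_of_md hτ (F := fun _ p => f p + g p)
    (hτ.add (F := fun _ => f) (G := fun _ => g) (md_fixed hf.1 hf.2) (md_fixed hg.1 hg.2)) 0

theorem cc_CB (hτ : TD τ) : CinftyB (cc τ) := by
  refine cb_add hτ ?_ ?_
  · have h := hτ.mul (hτ.con (mod_zz hτ)) (hτ.add (hτ.con (E := ℝ) (IsMod.const 1))
      (hτ.mul (hτ.con (IsMod.const (-1))) (md_cut hτ)))
    have := cb_of_md hτ (md_lift hτ h) 0
    convert this using 2 with p
    unfold ctop; ring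
  · exact Ng.cinftyB hτ.summ (hτ.nadd (hτ.nmul (hτ.con (IsMod.const (-1)))
      (hτ.nmul (md_co hτ) (hτ.nmul (md_co1 hτ) (ng_lift hτ (ng_kap hτ).1))))
      (ng_lift hτ (ng_kap hτ).2))

/-- derivative of separated products -/
theorem fd_prod (hτ : TD τ) {g : ℝ → ℝ} {f : ℝ → ℝ} {g' f' a c : ℝ} {k : ℕ} {p : ℝ × ℝ × ℝ}
    (hg : HasDerivAt g g' (a * XL k p)) (hf : HasDerivAt f f' p.1) (v : ℝ × ℝ × ℝ) :
    fderiv ℝ (fun p => c * (g (a * XL k p) * f p.1)) p v =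
      c * (g (a * XL k p) * (f' * v.1) + g' * (a * ex k v) * f p.1) := by
  have h1 : HasFDerivAt (fun p => g (a * XL k p)) (g' • (a • XL k)) p :=
    hg.comp_hasFDerivAt p ((XL k).hasFDerivAt.const_mul a)
  have h2 : HasFDerivAt (fun p : ℝ × ℝ × ℝ => f p.1)
      (f' • ContinuousLinearMap.fst ℝ ℝ (ℝ × ℝ)) p :=
    HasDerivAt.comp_hasFDerivAt p hf hasFDerivAt_fst
  have h3 : HasFDerivAt (fun p => c * (g (a * XL k p) * f p.1)) _ p := (h1.mul h2).const_mul c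
  rw [h3.fderiv]
  simp [ex]
  ring

theorem fd_F0 (hτ : TD τ) (k : ℕ) (p v : ℝ × ℝ × ℝ) : fderiv ℝ (F0 τ k) p v =
    co τ k p * ((ww' τ k p.1 * Real.exp (th τ k p.1) + rate τ k p.1 * amp τ k p.1) * v.1) +
      F1 τ v k p := by
  have := fd_prod hτ (a := xi τ k) (k := k) (c := 1) (Real.hasDerivAt_cos _)
    (amp_hasDerivAt hτ k p.1) v
  simp only [one_mul] at this
  unfold F0 co
  rw [this]
  unfold F1 si
  ring

theorem fd_F1 (hτ : TD τ) (k : ℕ) (p v w : ℝ × ℝ × ℝ) (hw : w.1 = 0) : fderiv ℝ (F1 τ v k) p w =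
    -(zz τ k * (ex k v * ex k w)) * (co τ k p * amp τ k p.1) := by
  have := fd_prod hτ (a := xi τ k) (k := k) (c := -(xi τ k * ex k v)) (Real.hasDerivAt_sin _)
    (amp_hasDerivAt hτ k p.1) w
  unfold F1 si
  rw [this, hw, zz_eq hτ]
  unfold co
  ring

theorem fd_u (hτ : TD τ) (p v : ℝ × ℝ × ℝ) : fderiv ℝ (uu τ) p v = ∑' k,
    (co τ k p * ((ww' τ k p.1 * Real.exp (th τ k p.1) + rate τ k p.1 * amp τ k p.1) * v.1) +
      F1 τ v k p) := by
  unfold uu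
  rw [(ng_F0 hτ).fderiv_tsum hτ.summ]
  exact tsum_congr fun k => fd_F0 hτ k p v

theorem fd_u' (hτ : TD τ) (p v : ℝ × ℝ × ℝ) (hv : v.1 = 0) : fderiv ℝ (uu τ) p v = ∑' k, F1 τ v k p := by
  rw [fd_u hτ]
  simp [hv]

theorem fd_uu (hτ : TD τ) (p v : ℝ × ℝ × ℝ) (hv : v.1 = 0) :
    fderiv ℝ (fun q => fderiv ℝ (uu τ) q v) p v =
      ∑' k, -(zz τ k * (ex k v * ex k v)) * (co τ k p * amp τ k p.1) := by
  have : (fun q => fderiv ℝ (uu τ) q v) = fun q => ∑' k, F1 τ v k q :=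
    funext fun q => fd_u' hτ q v hv
  rw [this, (ng_F1 hτ v).fderiv_tsum hτ.summ]
  exact tsum_congr fun k => fd_F1 hτ k p v v hv

end

theorem tsum_two {f : ℕ → ℝ} {k : ℕ} (h : ∀ j, j ≠ k → j ≠ k + 1 → f j = 0) :
    ∑' j, f j = f k + f (k + 1) := by
  rw [tsum_eq_sum (s := {k, k + 1})]
  · rw [Finset.sum_pair (by omega)]
  · intro j hj
    simp only [Finset.mem_insert, Finset.mem_singleton, not_or] at hj
    exact h j hj.1 hj.2

section
variable {τ : ℕ → ℝ}

theorem uu_zero (hτ : TD τ) {p : ℝ × ℝ × ℝ} (hp : p.1 ≤ 0) : uu τ p = 0 := by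
  unfold uu F0
  simp [fun k => (left_zero (S_neg hτ hp k)).1]

theorem pde (hτ : TD τ) (p : ℝ × ℝ × ℝ) :
    fderiv ℝ (uu τ) p (1, 0, 0) +
      fderiv ℝ (fun q => fderiv ℝ (uu τ) q ((0:ℝ), (1:ℝ), (0:ℝ))) p (0, 1, 0) +
      ll τ p.1 * fderiv ℝ (fun q => fderiv ℝ (uu τ) q ((0:ℝ), (0:ℝ), (1:ℝ))) p (0, 0, 1) +
      b1 τ p * fderiv ℝ (uu τ) p (0, 1, 0) +
      b2 τ p * fderiv ℝ (uu τ) p (0, 0, 1) +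
      cc τ p * uu τ p = 0 := by
  rw [fd_uu hτ p _ rfl, fd_uu hτ p _ rfl, fd_u' hτ p (0, 1, 0) rfl, fd_u' hτ p (0, 0, 1) rfl,
    fd_u hτ]
  rcases le_or_gt p.1 0 with h | h
  · rw [uu_zero hτ h]
    have h1 := fun k => (left_zero (S_neg hτ h k)).1
    have h2 := fun k => (left_zero (S_neg hτ h k)).2.1
    simp [F1, h1, h2]
  · obtain ⟨k, hk⟩ := exists_loc hτ h
    have z := fun j h1 h2 => hk.amp_zero (j := j) h1 h2
    have y := fun j h1 => hk.kap_zero (j := j) h1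
    obtain ⟨i1, i2⟩ := hk.ident hτ
    have r1 := hk.rate_eq hτ k
    have r2 := hk.rate_eq hτ (k + 1)
    have w1 : b1 τ p = ex k (0, 1, 0) * BL τ k p + ex k (0, 0, 1) * BH τ k p :=
      tsum_eq_single k (fun j h1 => by simp [BL, BH, (y j h1).1])
    have w2 : b2 τ p = ex k (0, 0, 1) * BL τ k p + ex k (0, 1, 0) * BH τ k p :=
      tsum_eq_single k (fun j h1 => by simp [BL, BH, (y j h1).1])
    have w3 : cc τ p = ctop τ p.1 +
        (-1 * (co τ k p * (co τ (k + 1) p * kap τ k p.1)) + zet τ k p.1) := by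
      unfold cc
      congr 1
      exact tsum_eq_single k (fun j h1 => by simp [(y j h1).1, (y j h1).2.1])
    have w4 : uu τ p = F0 τ k p + F0 τ (k + 1) p :=
      tsum_two (fun j h1 h2 => by simp [F0, (z j h1 h2).1])
    have w5 := fun v => tsum_two (k := k) (f := fun j => F1 τ v j p)
      (fun j h1 h2 => by simp [F1, (z j h1 h2).1])
    have w6 := fun v => tsum_two (k := k)
      (f := fun j => -(zz τ j * (ex j v * ex j v)) * (co τ j p * amp τ j p.1))
      (fun j h1 h2 => by simp [(z j h1 h2).1])
    have w7 := fun v : ℝ × ℝ × ℝ => tsum_two (k := k)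
      (f := fun j => co τ j p * ((ww' τ j p.1 * Real.exp (th τ j p.1) +
        rate τ j p.1 * amp τ j p.1) * v.1) + F1 τ v j p)
      (fun j h1 h2 => by simp [F1, (z j h1 h2).1, (z j h1 h2).2])
    beta_reduce at w5 w6 w7
    rw [w1, w2, w3, w4, w5, w5, w6, w6, w7]
    have hx := mul_inv_cancel₀ (xi_pos hτ k).ne'
    have hy := mul_inv_cancel₀ (xi_pos hτ (k + 1)).ne'
    have s1 : co τ k p ^ 2 + si τ k p ^ 2 = 1 := Real.cos_sq_add_sin_sq _
    have s2 : co τ (k + 1) p ^ 2 + si τ (k + 1) p ^ 2 = 1 := Real.cos_sq_add_sin_sq _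
    rw [i1, i2, r1, r2]
    unfold F1 F0 BL BH
    have key : ∀ (x x' y y' A B C D s s' K : ℝ), x * x' = 1 → y * y' = 1 → C ^ 2 + s ^ 2 = 1 →
        D ^ 2 + s' ^ 2 = 1 → K * B * C + K * A * D - (x' * (D * (s * K))) * (x * (s * A))
          - (y' * (C * (s' * K))) * (y * (s' * B)) - (C * (D * K)) * (C * A + D * B) = 0 := by
      intro x x' y y' A B C D s s' K h1 h2 h3 h4
      linear_combination (-(K * A * D * s ^ 2)) * h1 - (K * B * C * s' ^ 2) * h2
        - K * A * D * h3 - K * B * C * h4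
    have := key _ _ _ _ (amp τ k p.1) (amp τ (k + 1) p.1) _ _ _ _ (kap τ k p.1) hx hy s1 s2
    by_cases he : Even k
    · have ho : ¬ Even (k + 1) := by rw [Nat.even_add_one]; simpa using he
      simp only [ex_even he, ex_odd ho, he, ho, if_true, if_false]
      linear_combination this
    · have ho : Even (k + 1) := by rw [Nat.even_add_one]; simpa using he
      simp only [ex_odd he, ex_even ho, he, ho, if_true, if_false]
      linear_combination this

theorem supp_uu (hτ : TD τ) : tsupport (uu τ) = {p : ℝ × ℝ × ℝ | 0 ≤ p.1} := by
  apply Subset.antisymm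
  · refine closure_minimal (fun p hp => ?_) (isClosed_le continuous_const continuous_fst)
    by_contra h
    exact hp (uu_zero hτ (not_le.1 h).le)
  · have h1 : {p : ℝ × ℝ × ℝ | 0 ≤ p.1} = closure {p : ℝ × ℝ × ℝ | 0 < p.1} := by
      have e1 : {p : ℝ × ℝ × ℝ | 0 ≤ p.1} = Ici 0 ×ˢ univ := by ext; simp
      have e2 : {p : ℝ × ℝ × ℝ | 0 < p.1} = Ioi 0 ×ˢ univ := by ext; simp
      rw [e1, e2, closure_prod_eq, closure_Ioi, closure_univ]
    rw [h1]
    refine closure_minimal (fun p (hp : 0 < p.1) => ?_) (isClosed_tsupport _)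
    by_contra hn
    have hz : uu τ =ᶠ[𝓝 p] fun _ => (0:ℝ) := notMem_tsupport_iff_eventuallyEq.1 hn
    have d1 : ∀ v : ℝ × ℝ × ℝ, (fun q => fderiv ℝ (uu τ) q v) =ᶠ[𝓝 p] fun _ => 0 := fun v => by
      filter_upwards [hz.eventuallyEq_nhds] with q hq
      rw [hq.fderiv_eq]; simp
    have d2 : ∀ v : ℝ × ℝ × ℝ, fderiv ℝ (fun q => fderiv ℝ (uu τ) q v) p v = 0 := fun v => by
      rw [(d1 v).fderiv_eq]; simp
    obtain ⟨k, hk⟩ := exists_loc hτ hp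
    have z := fun j h1 h2 => hk.amp_zero (j := j) h1 h2
    have q1 : ∀ v : ℝ × ℝ × ℝ, v.1 = 0 → F1 τ v k p + F1 τ v (k + 1) p = 0 := fun v hv => by
      rw [← tsum_two (f := fun j => F1 τ v j p) (fun j h1 h2 => by simp [F1, (z j h1 h2).1]),
        ← fd_u' hτ p v hv]
      exact (d1 v).self_of_nhds
    have q2 : ∀ v : ℝ × ℝ × ℝ, v.1 = 0 →
        -(zz τ k * (ex k v * ex k v)) * (co τ k p * amp τ k p.1) +
        -(zz τ (k + 1) * (ex (k + 1) v * ex (k + 1) v)) * (co τ (k + 1) p * amp τ (k + 1) p.1)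
          = 0 := fun v hv => by
      rw [← tsum_two (f := fun j => -(zz τ j * (ex j v * ex j v)) * (co τ j p * amp τ j p.1))
        (fun j h1 h2 => by simp [(z j h1 h2).1]), ← fd_uu hτ p v hv]
      exact d2 v
    have hx := (xi_pos hτ k).ne'
    have hy := (xi_pos hτ (k + 1)).ne'
    have hzx := (zz_pos hτ k).ne'
    have hzy := (zz_pos hτ (k + 1)).ne'
    have s1 : co τ k p ^ 2 + si τ k p ^ 2 = 1 := Real.cos_sq_add_sin_sq _
    have s2 : co τ (k + 1) p ^ 2 + si τ (k + 1) p ^ 2 = 1 := Real.cos_sq_add_sin_sq _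
    have a1 := q1 (0, 1, 0) rfl
    have a2 := q1 (0, 0, 1) rfl
    have a3 := q2 (0, 1, 0) rfl
    have a4 := q2 (0, 0, 1) rfl
    have fin : ∀ A C s : ℝ, C ^ 2 + s ^ 2 = 1 → s * A = 0 → C * A = 0 → A = 0 := by
      intro A C s h1 h2 h3
      linear_combination (-A) * h1 + s * h2 + C * h3
    have hAB : amp τ k p.1 = 0 ∧ amp τ (k + 1) p.1 = 0 := by
      unfold F1 at a1 a2
      by_cases he : Even k
      · have ho : ¬ Even (k + 1) := by rw [Nat.even_add_one]; simpa using he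
        simp only [ex_even he, ex_odd ho, mul_one, mul_zero, neg_zero, zero_mul, add_zero, zero_add,
          mul_eq_zero, neg_eq_zero, hx, hy, hzx, hzy, false_or] at a1 a2 a3 a4
        exact ⟨fin _ _ _ s1 (by simpa using a1) (by simpa using a3),
          fin _ _ _ s2 (by simpa using a2) (by simpa using a4)⟩
      · have ho : Even (k + 1) := by rw [Nat.even_add_one]; simpa using he
        simp only [ex_odd he, ex_even ho, mul_one, mul_zero, neg_zero, zero_mul, add_zero, zero_add,
          mul_eq_zero, neg_eq_zero, hx, hy, hzx, hzy, false_or] at a1 a2 a3 a4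
        exact ⟨fin _ _ _ s1 (by simpa using a2) (by simpa using a4),
          fin _ _ _ s2 (by simpa using a1) (by simpa using a3)⟩
    obtain ⟨e1, -, e3, -⟩ := hk.ww_eq
    rcases le_or_gt (1 / 2) (S τ k p.1) with hS | hS
    · have := hAB.1
      rw [amp, e1] at this
      have h2 := mul_pos (chi_pos (show 1 / 8 < S τ k p.1 by linarith)) (Real.exp_pos (th τ k p.1))
      linarith
    · have := hAB.2
      rw [amp, e3] at this
      have h2 := mul_pos (chi_pos (show 1 / 8 < 1 - S τ k p.1 by linarith))
        (Real.exp_pos (th τ (k + 1) p.1))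
      linarith

end
end Plis

namespace Plis
open Real Set Filter Topology

/-! ### The sequence of time steps attached to `μ`, and the regularity of `l` -/

noncomputable def tau (μ : ℝ → ℝ) : ℕ → ℝ
  | 0 => 1 / 8
  | k + 1 => tau μ k * (1 - μ (tau μ k) / 100)

section
variable {μ : ℝ → ℝ}

theorem mu_pos (hm : StrictMonoOn μ (Set.Icc 0 1)) (hz : μ 0 = 0) {s : ℝ} (h0 : 0 < s) (h1 : s ≤ 1) : 0 < μ s := by
  rw [← hz]
  exact hm ⟨le_rfl, zero_le_one⟩ ⟨h0.le, h1⟩ h0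

theorem tau_bd (hmem : ∀ s ∈ Set.Icc (0:ℝ) 1, μ s ∈ Set.Icc (0:ℝ) 1) (k : ℕ) : 0 < tau μ k ∧ tau μ k ≤ 1 / 8 := by
  induction k with
  | zero => simp [tau]
  | succ k ih =>
    have := hmem (tau μ k) ⟨ih.1.le, by linarith [ih.2]⟩
    simp only [tau]
    refine ⟨mul_pos ih.1 (by linarith [this.2]), ?_⟩
    nlinarith [this.1, this.2, ih.1, ih.2]

theorem mu_tau (hmem : ∀ s ∈ Set.Icc (0:ℝ) 1, μ s ∈ Set.Icc (0:ℝ) 1) (k : ℕ) : 0 ≤ μ (tau μ k) ∧ μ (tau μ k) ≤ 1 := by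
  have h := tau_bd hmem k
  exact hmem (tau μ k) ⟨h.1.le, by linarith [h.2]⟩

theorem tau_anti (hmem : ∀ s ∈ Set.Icc (0:ℝ) 1, μ s ∈ Set.Icc (0:ℝ) 1) (k : ℕ) : tau μ (k + 1) ≤ tau μ k := by
  have h := tau_bd hmem k
  have h2 := mu_tau hmem k
  simp only [tau]
  nlinarith [h2.1, h.1]

theorem tau_summable (hm : StrictMonoOn μ (Set.Icc 0 1)) (hz : μ 0 = 0) (hmem : ∀ s ∈ Set.Icc (0:ℝ) 1, μ s ∈ Set.Icc (0:ℝ) 1) (hi : ∫⁻ s in Set.Ioo (0:ℝ) 1, ENNReal.ofReal (1 / μ s) < ⊤) :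
    Summable (tau μ) := by
  have hanti : Antitone (tau μ) := antitone_nat_of_succ_le (tau_anti hmem)
  have h1 : ∀ k, ENNReal.ofReal (tau μ k / 100) ≤
      ∫⁻ s in Ioc (tau μ (k + 1)) (tau μ k), ENNReal.ofReal (1 / μ s) := by
    intro k
    have hb := tau_bd hmem k
    have hb' := tau_bd hmem (k + 1)
    have hp := mu_pos hm hz hb.1 (by linarith [hb.2])
    calc ENNReal.ofReal (tau μ k / 100)
        = ENNReal.ofReal (1 / μ (tau μ k)) * ENNReal.ofReal (tau μ k - tau μ (k + 1)) := by
          rw [← ENNReal.ofReal_mul (by positivity)]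
          congr 1
          simp only [tau]
          field_simp
          ring
      _ = ∫⁻ s in Ioc (tau μ (k + 1)) (tau μ k), ENNReal.ofReal (1 / μ (tau μ k)) := by
          rw [MeasureTheory.setLIntegral_const, Real.volume_Ioc]
      _ ≤ _ := by
          refine MeasureTheory.setLIntegral_mono' measurableSet_Ioc fun s hs => ?_
          apply ENNReal.ofReal_le_ofReal
          have hs0 : 0 < s := hb'.1.trans hs.1
          have hs1 : s ≤ 1 := hs.2.trans (by linarith [hb.2])
          have := mu_pos hm hz hs0 hs1
          apply one_div_le_one_div_of_le this
          exact hm.monotoneOn ⟨hs0.le, hs1⟩ ⟨hb.1.le, by linarith [hb.2]⟩ hs.2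
  have h2 : ∑' k, ENNReal.ofReal (tau μ k / 100) ≠ ⊤ := by
    refine ne_top_of_le_ne_top hi.ne ?_
    refine (ENNReal.tsum_le_tsum h1).trans ?_
    rw [← MeasureTheory.lintegral_iUnion (fun k => measurableSet_Ioc)]
    · apply MeasureTheory.lintegral_mono_set
      intro s hs
      obtain ⟨k, hk⟩ := mem_iUnion.1 hs
      exact ⟨(tau_bd hmem (k + 1)).1.trans hk.1, by linarith [hk.2, (tau_bd hmem k).2]⟩
    · exact hanti.pairwise_disjoint_on_Ioc_succ
  have h3 := ENNReal.summable_toReal h2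
  have h4 := h3.mul_left 100
  refine h4.congr fun k => ?_
  have := (tau_bd hmem k).1
  rw [ENNReal.toReal_ofReal (by positivity)]
  ring

theorem tau_TD (hm : StrictMonoOn μ (Set.Icc 0 1)) (hz : μ 0 = 0) (hmem : ∀ s ∈ Set.Icc (0:ℝ) 1, μ s ∈ Set.Icc (0:ℝ) 1) (hi : ∫⁻ s in Set.Ioo (0:ℝ) 1, ENNReal.ofReal (1 / μ s) < ⊤) : TD (tau μ) where
  pos k := (tau_bd hmem k).1
  le8 k := (tau_bd hmem k).2
  anti := tau_anti hmem
  low k := by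
    have h := tau_bd hmem k
    have h2 := mu_tau hmem k
    simp only [tau]
    nlinarith [h2.2, h.1]
  summ := tau_summable hm hz hmem hi

theorem mu_conc (hc : ConcaveOn ℝ (Set.Icc 0 1) μ) (hz : μ 0 = 0) {h t : ℝ} (h0 : 0 ≤ h) (hle : h ≤ t) (h1 : t ≤ 1) (ht : 0 < t) :
    h / t * μ t ≤ μ h := by
  have a : 0 ≤ h / t := by positivity
  have b : h / t ≤ 1 := (div_le_one ht).2 hle
  have := hc.2 (x := t) (y := 0) ⟨ht.le, h1⟩ ⟨le_rfl, zero_le_one⟩ a (sub_nonneg.2 b) (by ring)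
  simp only [smul_eq_mul, hz, mul_zero, add_zero] at this
  rwa [div_mul_cancel₀ _ ht.ne'] at this

theorem del_mu (hc : ConcaveOn ℝ (Set.Icc 0 1) μ) (hm : StrictMonoOn μ (Set.Icc 0 1)) (hz : μ 0 = 0) (hmem : ∀ s ∈ Set.Icc (0:ℝ) 1, μ s ∈ Set.Icc (0:ℝ) 1) (hτ : TD (tau μ)) :
    ∃ C, 0 ≤ C ∧ ∀ k, |del (tau μ) k| ≤ C * μ (tau μ k) := by
  have hp1 := mu_pos hm hz zero_lt_one le_rfl
  refine ⟨2 / μ 1 + 5 / 100, by positivity, fun k => ?_⟩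
  refine (del_abs hτ k).trans ?_
  have h := tau_bd hmem k
  have h2 := mu_tau hmem k
  set t := tau μ k with ht
  have e1 : tau μ (k + 1) = t * (1 - μ t / 100) := rfl
  have hpos : 0 < 1 - μ t / 100 := by linarith [h2.2]
  have h3 : (2 * t⁻¹ ^ 2 + zz (tau μ) (k + 1) - zz (tau μ) k) / zz (tau μ) k =
      2 * t ^ 2 + (((1 - μ t / 100) ^ 4)⁻¹ - 1) := by
    unfold zz
    rw [e1, ← ht]
    have := h.1
    field_simp
    ring
  rw [h3]
  have h4 : ((1 - μ t / 100) ^ 4)⁻¹ ≤ 1 + 5 / 100 * μ t := by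
    rw [inv_le_iff_one_le_mul₀ (by positivity)]
    have h5 : 1 - 4 * (μ t / 100) ≤ (1 - μ t / 100) ^ 4 := by
      have := one_add_mul_le_pow (a := -(μ t / 100)) (by linarith [h2.2]) 4
      push_cast at this
      calc _ = 1 + 4 * (-(μ t / 100)) := by ring
        _ ≤ _ := this
        _ = _ := by ring
    calc (1:ℝ) ≤ (1 + 5 / 100 * μ t) * (1 - 4 * (μ t / 100)) := by nlinarith [h2.1, h2.2]
      _ ≤ _ := mul_le_mul_of_nonneg_left h5 (by linarith [h2.1])
  have h6 : 2 * t ^ 2 ≤ 2 / μ 1 * μ t := by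
    have h7 := mu_conc hc hz (h := t) (t := 1) h.1.le (by linarith [h.2]) le_rfl zero_lt_one
    rw [div_one] at h7
    have h8 : t ≤ μ t / μ 1 := by rwa [le_div_iff₀ hp1]
    have h9 : t ^ 2 ≤ t := by nlinarith [h.1, h.2]
    calc 2 * t ^ 2 ≤ 2 * (μ t / μ 1) := by linarith
      _ = _ := by ring
  linarith

theorem psi_lip : ∃ L, 0 ≤ L ∧ ∀ a b, |psi a - psi b| ≤ L * |a - b| := by
  obtain ⟨C, hC⟩ := bdd_of_compact psi_contDiff psi_compact 1
  refine ⟨C, (norm_nonneg _).trans (hC 0), fun a b => ?_⟩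
  have := Convex.norm_image_sub_le_of_norm_fderiv_le (f := psi) (s := univ) (x := b) (y := a) (C := C)
    (𝕜 := ℝ) (fun x _ => (psi_contDiff.differentiable (by simp)) x)
    (fun x _ => by rw [← norm_iteratedFDeriv_one]; exact hC x) convex_univ (mem_univ _) (mem_univ _)
  simpa [Real.norm_eq_abs] using this

theorem ff_mu (hc : ConcaveOn ℝ (Set.Icc 0 1) μ) (hm : StrictMonoOn μ (Set.Icc 0 1)) (hz : μ 0 = 0) (hmem : ∀ s ∈ Set.Icc (0:ℝ) 1, μ s ∈ Set.Icc (0:ℝ) 1) (hτ : TD (tau μ)) : ∃ C, ∀ k t s, 0 < |t - s| → |t - s| < 1 →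
    |ff (tau μ) k t - ff (tau μ) k s| ≤ C * μ |t - s| := by
  obtain ⟨C, hC0, hC⟩ := del_mu hc hm hz hmem hτ
  obtain ⟨L, hL0, hL⟩ := psi_lip
  refine ⟨C * (1 + L), fun k t s h0 h1 => ?_⟩
  have hk := hτ.pos k
  have hk8 := hτ.le8 k
  have hmp := mu_pos hm hz h0 h1.le
  have hmk := (mu_tau hmem k).1
  have e : ff (tau μ) k t - ff (tau μ) k s =
      del (tau μ) k * (psi (S (tau μ) k t) - psi (S (tau μ) k s)) := by unfold ff; ring
  rw [e, abs_mul]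
  have key : μ (tau μ k) * |psi (S (tau μ) k t) - psi (S (tau μ) k s)| ≤ (1 + L) * μ |t - s| := by
    rcases le_total (tau μ k) |t - s| with hcase | hcase
    · have m1 : μ (tau μ k) ≤ μ |t - s| :=
        hm.monotoneOn ⟨hk.le, by linarith⟩ ⟨h0.le, h1.le⟩ hcase
      have m2 : |psi (S (tau μ) k t) - psi (S (tau μ) k s)| ≤ 1 := by
        rw [abs_le]
        have := psi_nonneg (S (tau μ) k t)
        have := psi_nonneg (S (tau μ) k s)
        have := psi_le_one (S (tau μ) k t)
        have := psi_le_one (S (tau μ) k s)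
        constructor <;> linarith
      calc _ ≤ μ |t - s| * 1 := by gcongr
        _ ≤ _ := by nlinarith
    · have m1 := mu_conc hc hz h0.le hcase (by linarith) hk
      have m2 := hL (S (tau μ) k t) (S (tau μ) k s)
      have m3 : |S (tau μ) k t - S (tau μ) k s| = |t - s| / tau μ k := by
        unfold S
        rw [← sub_div, abs_div, abs_of_pos hk]
        congr 2; ring
      rw [m3] at m2
      calc _ ≤ μ (tau μ k) * (L * (|t - s| / tau μ k)) := by gcongr
        _ = L * (|t - s| / tau μ k * μ (tau μ k)) := by ring
        _ ≤ L * μ |t - s| := by gcongr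
        _ ≤ _ := by nlinarith
  calc _ ≤ (C * μ (tau μ k)) * |psi (S (tau μ) k t) - psi (S (tau μ) k s)| := by
        gcongr; exact hC k
    _ = C * (μ (tau μ k) * |psi (S (tau μ) k t) - psi (S (tau μ) k s)|) := by ring
    _ ≤ C * ((1 + L) * μ |t - s|) := by gcongr
    _ = _ := by ring

end

theorem ff_single {τ : ℕ → ℝ} (hτ : TD τ) (t : ℝ) :
    ∃ k, (∀ j, j ≠ k → ff τ j t = 0) ∧ ll τ t = 1 + ff τ k t := by
  have : ∃ k, ∀ j, j ≠ k → ff τ j t = 0 := by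
    rcases le_or_gt t 0 with h | h
    · exact ⟨0, fun j _ => (left_zero (S_neg hτ h j)).2.2.2.2⟩
    · obtain ⟨k, hk⟩ := exists_loc hτ h
      exact ⟨k, fun j hj => (hk.kap_zero hj).2.2⟩
  obtain ⟨k, hk⟩ := this
  refine ⟨k, hk, ?_⟩
  unfold ll
  rw [tsum_eq_single k hk]

theorem ll_range {τ : ℕ → ℝ} (hτ : TD τ) (t : ℝ) : ll τ t ∈ Icc (1 / 2 : ℝ) (3 / 2) := by
  obtain ⟨k, -, h⟩ := ff_single hτ t
  have := abs_le.1 (ff_abs hτ k t)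
  rw [h]
  constructor <;> linarith [this.1, this.2]

theorem ll_mod {μ : ℝ → ℝ} {τ : ℕ → ℝ} (hτ : TD τ) {C : ℝ}
    (hC : ∀ k t s, 0 < |t - s| → |t - s| < 1 → |ff τ k t - ff τ k s| ≤ C * μ |t - s|) (t s : ℝ)
    (h0 : 0 < |t - s|) (h1 : |t - s| < 1) : |ll τ t - ll τ s| ≤ 2 * C * μ |t - s| := by
  obtain ⟨k, hk, hk'⟩ := ff_single hτ t
  obtain ⟨j, hj, hj'⟩ := ff_single hτ s
  have a := hC k t s h0 h1
  have b := hC j t s h0 h1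
  rw [hk', hj']
  by_cases e : k = j
  · subst e
    have : 0 ≤ C * μ |t - s| := (abs_nonneg _).trans a
    rw [add_sub_add_left_eq_sub]
    linarith
  · rw [hj k e] at a
    rw [hk j (Ne.symm e)] at b
    have : 1 + ff τ k t - (1 + ff τ j s) = (ff τ k t - 0) + (0 - ff τ j s) := by ring
    rw [this]
    refine (abs_add_le _ _).trans ?_
    linarith

end Plis

/-- (Non-uniqueness when the Osgood condition fails.) Let `μ` be
a modulus of continuity with `∫₀¹ 1/μ(s) ds < +∞`. Then there are `l ∈ C^μ(ℝ)`
with `1/2 ≤ l ≤ 3/2` and `u, b₁, b₂, c ∈ C^∞_b(ℝ_t × ℝ²_x)` with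
`supp u = {t ≥ 0}` such that
`∂_t u + ∂²_{x₁} u + l ∂²_{x₂} u + b₁ ∂_{x₁} u + b₂ ∂_{x₂} u + c u = 0`
on `ℝ × ℝ²`. (Points of `ℝ_t × ℝ²_x` are written `p = (t, x₁, x₂)`.) -/
theorem backward_nonuniqueness_of_non_osgood
    (μ : ℝ → ℝ)
    (hμ_cont : ContinuousOn μ (Set.Icc 0 1))
    (hμ_conc : ConcaveOn ℝ (Set.Icc 0 1) μ)
    (hμ_mono : StrictMonoOn μ (Set.Icc 0 1))
    (hμ_zero : μ 0 = 0)
    (hμ_mem : ∀ s ∈ Set.Icc (0:ℝ) 1, μ s ∈ Set.Icc (0:ℝ) 1)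
    (hnonOsgood : ∫⁻ s in Set.Ioo (0:ℝ) 1, ENNReal.ofReal (1 / μ s) < ⊤) :
    ∃ l : ℝ → ℝ,
      (∃ M, ∀ t s : ℝ, 0 < |t - s| → |t - s| < 1 → |l t - l s| ≤ M * μ |t - s|) ∧
      (∀ t, l t ∈ Set.Icc (1/2 : ℝ) (3/2)) ∧
      ∃ u b₁ b₂ c : ℝ × ℝ × ℝ → ℝ,
        CinftyB u ∧ CinftyB b₁ ∧ CinftyB b₂ ∧ CinftyB c ∧
        tsupport u = {p : ℝ × ℝ × ℝ | 0 ≤ p.1} ∧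
        ∀ p : ℝ × ℝ × ℝ,
          fderiv ℝ u p (1, 0, 0) +
            fderiv ℝ (fun q => fderiv ℝ u q ((0:ℝ), (1:ℝ), (0:ℝ))) p (0, 1, 0) +
            l p.1 * fderiv ℝ (fun q => fderiv ℝ u q ((0:ℝ), (0:ℝ), (1:ℝ))) p (0, 0, 1) +
            b₁ p * fderiv ℝ u p (0, 1, 0) +
            b₂ p * fderiv ℝ u p (0, 0, 1) +
            c p * u p = 0 := by
  obtain hτ := Plis.tau_TD hμ_mono hμ_zero hμ_mem hnonOsgood
  obtain ⟨C, hC⟩ := Plis.ff_mu hμ_conc hμ_mono hμ_zero hμ_mem hτ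
  exact ⟨Plis.ll (Plis.tau μ), ⟨2 * C, Plis.ll_mod hτ hC⟩, Plis.ll_range hτ,
    Plis.uu (Plis.tau μ), Plis.b1 (Plis.tau μ), Plis.b2 (Plis.tau μ), Plis.cc (Plis.tau μ),
    Plis.uu_CB hτ, Plis.b1_CB hτ, Plis.b2_CB hτ, Plis.cc_CB hτ, Plis.supp_uu hτ, Plis.pde hτ⟩
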